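/- arXiv:1805.02945 — 2 statements merged into one kernel-verified Lean document; each statement's English description precedes it below -/
import Mathlib

section
/- For every ε > 0, the set of positive integers n satisfying f₃(4,n) ≥ exp( (log 6 − ε) · log log n ) has natural density one, i.e. the proportion of n ≤ x lying in this set tends to 1 as x → ∞. -/
/-- `numSols k m n` is the number of nondecreasing `k`-tuples of positive integers
`(a₁, …, a_k)` with `m / n = 1/a₁ + ⋯ + 1/a_k`. -/
noncomputable def numSols (k m n : ℕ) : ℕ :=
  Nat.card {a : Fin k → ℕ // (∀ i, 0 < a i) ∧ Monotone a ∧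
    (m : ℚ) / n = ∑ i, (1 : ℚ) / a i}

/-- ordered solutions -/
def OrdSol (n : ℕ) : Set (Fin 3 → ℕ) :=
  {a | (∀ i, 0 < a i) ∧ (4 : ℚ) / n = ∑ i, (1 : ℚ) / a i}

lemma three_bound {n x y z : ℕ} (hn : 0 < n) (hx : 0 < x) (hxy : x ≤ y) (hyz : y ≤ z)
    (h : (4 : ℚ) / n = 1 / x + 1 / y + 1 / z) : z ≤ n * n * (2 * n * n) := by
  have hy : 0 < y := by omega
  have hz : 0 < z := by omega
  have hnQ : (0 : ℚ) < n := by exact_mod_cast hn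
  have hxQ : (0 : ℚ) < x := by exact_mod_cast hx
  have hyQ : (0 : ℚ) < y := by exact_mod_cast hy
  have hzQ : (0 : ℚ) < z := by exact_mod_cast hz
  have h1 : 4 * x * y * z = n * (y * z + x * z + x * y) := by
    field_simp at h
    have : (4 * x * y * z : ℚ) = n * (y * z + x * z + x * y) := by linarith
    exact_mod_cast this
  have hxn : x ≤ n := by
    by_contra hc
    push Not at hc
    have e1 : x * z ≤ y * z := Nat.mul_le_mul_right _ hxy
    have e2 : x * y ≤ y * z := by nlinarith
    have e3 : n * (y * z + x * z + x * y) ≤ n * (3 * (y * z)) := Nat.mul_le_mul_left _ (by omega)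
    have e4 : n * (y * z) < x * (y * z) := Nat.mul_lt_mul_of_pos_right hc (by positivity)
    nlinarith
  have hxn' : n < 4 * x := by
    by_contra hc
    push Not at hc
    have : 4 * x * (y * z) ≤ n * (y * z) := Nat.mul_le_mul_right _ hc
    have : 0 < n * (x * z + x * y) := by positivity
    nlinarith
  obtain ⟨c, hc⟩ : ∃ c, 4 * x = n + c := ⟨4 * x - n, by omega⟩
  have hc0 : 0 < c := by omega
  have h2 : c * (y * z) = n * x * (y + z) := by
    have : (n + c) * (y * z) = n * (y * z + x * z + x * y) := by rw [← hc, ← h1]; ring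
    nlinarith
  have hyb : y ≤ 2 * (n * x) := by
    by_contra hh
    push Not at hh
    have e1 : n * x * (y + z) ≤ n * x * (2 * z) := Nat.mul_le_mul_left _ (by omega)
    have e2 : y * z ≤ c * (y * z) := Nat.le_mul_of_pos_left _ hc0
    have e3 : 2 * (n * x) * z < y * z := Nat.mul_lt_mul_of_pos_right hh hz
    nlinarith
  have h3 : n * x < c * y := by
    by_contra hh
    push Not at hh
    have : c * y * z ≤ n * x * z := Nat.mul_le_mul_right _ hh
    have : 0 < n * x * y := by positivity
    nlinarith
  obtain ⟨d, hd⟩ : ∃ d, c * y = n * x + d := ⟨c * y - n * x, by omega⟩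
  have h4 : d * z = n * x * y := by
    have : (n * x + d) * z = n * x * (y + z) := by rw [← hd, ← h2]; ring
    nlinarith
  have h5 : z ≤ n * x * y := by
    rw [← h4]; exact Nat.le_mul_of_pos_left _ (by omega)
  calc z ≤ n * x * y := h5
    _ ≤ n * n * (2 * (n * n)) := by gcongr; exact hyb.trans (by gcongr)
    _ = _ := by ring

lemma sorted_finite {n : ℕ} (hn : 0 < n) : Finite {a : Fin 3 → ℕ // (∀ i, 0 < a i) ∧ Monotone a ∧
    ((4 : ℕ) : ℚ) / n = ∑ i, (1 : ℚ) / a i} := by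
  apply Set.Finite.subset (Set.finite_Iic (fun _ : Fin 3 => n * n * (2 * n * n)))
  rintro a ⟨h0, hm, h⟩
  have h01 : a 0 ≤ a 1 := hm (by decide)
  have h12 : a 1 ≤ a 2 := hm (by decide)
  rw [Fin.sum_univ_three] at h
  have := three_bound hn (h0 0) h01 h12 (by exact_mod_cast h)
  intro i
  fin_cases i <;> simp <;> omega

lemma ordSol_card {n : ℕ} (hn : 0 < n) :
    (OrdSol n).Finite ∧ (OrdSol n).ncard ≤ 6 * numSols 3 4 n := by
  have := sorted_finite hn
  let g : OrdSol n → Equiv.Perm (Fin 3) × {a : Fin 3 → ℕ // (∀ i, 0 < a i) ∧ Monotone a ∧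
    ((4 : ℕ) : ℚ) / n = ∑ i, (1 : ℚ) / a i} := fun a =>
    (Tuple.sort a.1, ⟨a.1 ∘ Tuple.sort a.1, fun i => a.2.1 _, Tuple.monotone_sort a.1, by
      have h1 := a.2.2
      have h2 := Equiv.sum_comp (Tuple.sort a.1) (fun i => (1 : ℚ) / a.1 i)
      simp only [Function.comp]
      rw [h2]; exact_mod_cast h1⟩)
  have hg : Function.Injective g := by
    intro a b hab
    have h1 : Tuple.sort a.1 = Tuple.sort b.1 := congrArg Prod.fst hab
    have h2 : a.1 ∘ Tuple.sort a.1 = b.1 ∘ Tuple.sort b.1 :=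
      congrArg (fun t => t.2.1) hab
    rw [h1] at h2
    exact Subtype.ext ((Tuple.sort b.1).surjective.injective_comp_right h2)
  have hf : Finite (OrdSol n) := Finite.of_injective g hg
  refine ⟨hf, ?_⟩
  have := Nat.card_le_card_of_injective g hg
  rw [Nat.card_prod] at this
  have h6 : Nat.card (Equiv.Perm (Fin 3)) = 6 := by
    rw [Nat.card_eq_fintype_card, Fintype.card_perm]; rfl
  rw [h6] at this
  exact this

/-- admissible triples of sets of primes -/
structure Adm (n : ℕ) (A : Fin 3 → Finset ℕ) : Prop where
  sub : ∀ i, A i ⊆ n.primeFactors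
  h0 : (∏ p ∈ A 0, p) % 8 = 3
  h1 : (∏ p ∈ A 1, p) % 8 = 1
  h2 : (∏ p ∈ A 2, p) % 8 = 1
  emp : ∀ p, ¬ ∀ i, p ∈ A i

def DD (A : Fin 3 → Finset ℕ) (i : Fin 3) : ℕ := (if i = 0 then 2 else 1) * ∏ p ∈ A i, p

def SS (A : Fin 3 → Finset ℕ) : ℕ := ∑ i, DD A i

def sol (n : ℕ) (A : Fin 3 → Finset ℕ) (i : Fin 3) : ℕ := (2 * n / DD A i) * (SS A / 8)

lemma Adm.dvd {n : ℕ} {A : Fin 3 → Finset ℕ} (h : Adm n A) (i : Fin 3) : DD A i ∣ 2 * n := by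
  unfold DD
  apply Nat.mul_dvd_mul
  · split_ifs <;> simp
  · exact (Finset.prod_dvd_prod_of_subset _ _ _ (h.sub i)).trans (Nat.prod_primeFactors_dvd n)

lemma Adm.pos {n : ℕ} {A : Fin 3 → Finset ℕ} (h : Adm n A) (i : Fin 3) : 0 < DD A i := by
  unfold DD
  apply Nat.mul_pos
  · split_ifs <;> simp
  · exact Finset.prod_pos fun p hp => (Nat.prime_of_mem_primeFactors (h.sub i hp)).pos

lemma Adm.ss {n : ℕ} {A : Fin 3 → Finset ℕ} (h : Adm n A) : 8 ∣ SS A := by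
  have h0 := h.h0
  have h1 := h.h1
  have h2 := h.h2
  simp only [SS, DD, Fin.sum_univ_three]
  simp
  omega

lemma Adm.sspos {n : ℕ} {A : Fin 3 → Finset ℕ} (h : Adm n A) : 0 < SS A :=
  Finset.sum_pos (fun i _ => h.pos i) ⟨0, by simp⟩

lemma Adm.inv {n : ℕ} (hn : 0 < n) {A : Fin 3 → Finset ℕ} (h : Adm n A) (i : Fin 3) :
    (1 : ℚ) / sol n A i = 4 * DD A i / (n * SS A) := by
  obtain ⟨c, hc⟩ := h.dvd i
  obtain ⟨s, hs⟩ := h.ss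
  have hp := h.pos i
  have hsp := h.sspos
  have hs0 : 0 < s := by omega
  have hc0 : 0 < c := by
    rcases Nat.eq_zero_or_pos c with rfl | h'
    · omega
    · exact h'
  have hsol : sol n A i = c * s := by
    unfold sol
    rw [hc, hs, Nat.mul_div_cancel_left _ hp, Nat.mul_div_cancel_left _ (by norm_num)]
  have hcQ : (2 * n : ℚ) = DD A i * c := by exact_mod_cast hc
  rw [hsol, hs]
  push_cast
  have : (0 : ℚ) < DD A i := by exact_mod_cast hp
  have : (0 : ℚ) < s := by exact_mod_cast hs0
  have : (0 : ℚ) < c := by exact_mod_cast hc0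
  have : (0 : ℚ) < n := by exact_mod_cast hn
  field_simp
  linarith

lemma Adm.mem {n : ℕ} (hn : 0 < n) {A : Fin 3 → Finset ℕ} (h : Adm n A) : sol n A ∈ OrdSol n := by
  have hs : (0 : ℚ) < SS A := by exact_mod_cast h.sspos
  have hnQ : (0 : ℚ) < n := by exact_mod_cast hn
  constructor
  · intro i
    have h1 := h.inv hn i
    have : (0 : ℚ) < DD A i := by exact_mod_cast h.pos i
    by_contra hc
    have hc : sol n A i = 0 := by omega
    rw [hc] at h1
    have : (0 : ℚ) < 4 * DD A i / (n * SS A) := by positivity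
    simp at h1
    grind
  · rw [Finset.sum_congr rfl (fun i _ => h.inv hn i), ← Finset.sum_div, ← Finset.mul_sum]
    have : (∑ i, (DD A i : ℚ)) = SS A := by unfold SS; push_cast; rfl
    rw [this]
    field_simp

lemma Adm.primeFactors {n : ℕ} {A : Fin 3 → Finset ℕ} (h : Adm n A) (i : Fin 3) :
    (∏ p ∈ A i, p).primeFactors = A i :=
  Nat.primeFactors_prod fun p hp => Nat.prime_of_mem_primeFactors (h.sub i hp)

lemma Adm.gcd {n : ℕ} {A : Fin 3 → Finset ℕ} (h : Adm n A) :
    Nat.gcd (DD A 0) (Nat.gcd (DD A 1) (DD A 2)) = 1 := by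
  by_contra hne
  obtain ⟨p, hp, hd⟩ := Nat.exists_prime_and_dvd hne
  have d0 : p ∣ DD A 0 := hd.trans (Nat.gcd_dvd_left _ _)
  have d1 : p ∣ DD A 1 := (hd.trans (Nat.gcd_dvd_right _ _)).trans (Nat.gcd_dvd_left _ _)
  have d2 : p ∣ DD A 2 := (hd.trans (Nat.gcd_dvd_right _ _)).trans (Nat.gcd_dvd_right _ _)
  have key : ∀ i, p ∣ ∏ q ∈ A i, q → p ∈ A i := by
    intro i hi
    rw [← h.primeFactors i]
    refine Nat.mem_primeFactors.2 ⟨hp, hi, ?_⟩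
    exact (Finset.prod_pos fun p hp => (Nat.prime_of_mem_primeFactors (h.sub i hp)).pos).ne'
  simp [DD] at d0 d1 d2
  have p2 : p ≠ 2 := by
    rintro rfl
    have := h.h1
    omega
  have d0' : p ∣ ∏ q ∈ A 0, q := by
    rcases (Nat.Prime.dvd_mul hp).1 d0 with h' | h'
    · exact absurd ((Nat.prime_dvd_prime_iff_eq hp Nat.prime_two).1 h') p2
    · exact h'
  apply h.emp p
  intro i
  fin_cases i
  · exact key _ d0'
  · exact key _ d1
  · exact key _ d2

lemma sol_inj {n : ℕ} (hn : 0 < n) {A B : Fin 3 → Finset ℕ} (hA : Adm n A) (hB : Adm n B)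
    (h : sol n A = sol n B) : A = B := by
  have hsA : (0 : ℚ) < SS A := by exact_mod_cast hA.sspos
  have hsB : (0 : ℚ) < SS B := by exact_mod_cast hB.sspos
  have hnQ : (0 : ℚ) < n := by exact_mod_cast hn
  have key : ∀ i, SS B * DD A i = SS A * DD B i := by
    intro i
    have h1 := hA.inv hn i
    rw [h, hB.inv hn i] at h1
    field_simp at h1
    have : (SS B * DD A i : ℚ) = SS A * DD B i := by linarith
    exact_mod_cast this
  have hS : SS B = SS A := by
    have e1 : Nat.gcd (SS B * DD A 0) (Nat.gcd (SS B * DD A 1) (SS B * DD A 2)) = SS B := by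
      rw [Nat.gcd_mul_left, Nat.gcd_mul_left, hA.gcd, mul_one]
    have e2 : Nat.gcd (SS A * DD B 0) (Nat.gcd (SS A * DD B 1) (SS A * DD B 2)) = SS A := by
      rw [Nat.gcd_mul_left, Nat.gcd_mul_left, hB.gcd, mul_one]
    rw [← e1, ← e2, key 0, key 1, key 2]
  funext i
  have h1 : DD A i = DD B i := by
    have := key i
    rw [hS] at this
    exact Nat.eq_of_mul_eq_mul_left hA.sspos this
  have h2 : ∏ p ∈ A i, p = ∏ p ∈ B i, p := by
    unfold DD at h1
    refine Nat.eq_of_mul_eq_mul_left ?_ h1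
    split_ifs <;> simp
  rw [← hA.primeFactors i, ← hB.primeFactors i, h2]

abbrev X7 := {x : Fin 3 → Bool // x ≠ fun _ => true}

lemma fix_res {u v : ℕ} (huv : u ≠ v) (hu : u % 8 = 3) (hv : v % 8 = 5) (e r : ℕ)
    (he : e % 2 = 1) (hr : r % 2 = 1) (hr8 : r < 8) :
    ∃ W : Finset ℕ, W ⊆ {u, v} ∧ (e * ∏ p ∈ W, p) % 8 = r := by
  have e8 : e % 8 = 1 ∨ e % 8 = 3 ∨ e % 8 = 5 ∨ e % 8 = 7 := by omega
  have r8 : r = 1 ∨ r = 3 ∨ r = 5 ∨ r = 7 := by omega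
  have p0 : (e * ∏ p ∈ (∅ : Finset ℕ), p) % 8 = e % 8 := by simp
  have p1 : (e * ∏ p ∈ ({u} : Finset ℕ), p) % 8 = (e % 8 * 3) % 8 := by
    simp [Nat.mul_mod, hu]
  have p2 : (e * ∏ p ∈ ({v} : Finset ℕ), p) % 8 = (e % 8 * 5) % 8 := by
    simp [Nat.mul_mod, hv]
  have p3 : (e * ∏ p ∈ ({u, v} : Finset ℕ), p) % 8 = (e % 8 * 7) % 8 := by
    rw [Finset.prod_pair huv]; simp [Nat.mul_mod, hu, hv]
  by_cases c0 : e % 8 = r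
  · exact ⟨∅, by simp, by rw [p0, c0]⟩
  by_cases c1 : e % 8 * 3 % 8 = r
  · exact ⟨{u}, by simp, by rw [p1, c1]⟩
  by_cases c2 : e % 8 * 5 % 8 = r
  · exact ⟨{v}, by simp, by rw [p2, c2]⟩
  by_cases c3 : e % 8 * 7 % 8 = r
  · exact ⟨{u, v}, by simp, by rw [p3, c3]⟩
  omega

lemma many_sols {n : ℕ} (hn : 0 < n) (h3 : 3 ≤ (n.primeFactors.filter (fun p => p % 8 = 3)).card)
    (h5 : 3 ≤ (n.primeFactors.filter (fun p => p % 8 = 5)).card) :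
    7 ^ n.primeFactors.card ≤ 7 ^ 8 * numSols 3 4 n := by
  classical
  obtain ⟨U, hU, hUc⟩ := Finset.exists_subset_card_eq h3
  obtain ⟨V, hV, hVc⟩ := Finset.exists_subset_card_eq h5
  let eu := U.equivFinOfCardEq hUc
  let ev := V.equivFinOfCardEq hVc
  let u : Fin 3 → ℕ := fun i => (eu.symm i).1
  let v : Fin 3 → ℕ := fun i => (ev.symm i).1
  have huU : ∀ i, u i ∈ U := fun i => (eu.symm i).2
  have hvV : ∀ i, v i ∈ V := fun i => (ev.symm i).2
  have hu : ∀ i, u i ∈ n.primeFactors ∧ u i % 8 = 3 := fun i => by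
    simpa only [Finset.mem_filter] using hU (huU i)
  have hv : ∀ i, v i ∈ n.primeFactors ∧ v i % 8 = 5 := fun i => by
    simpa only [Finset.mem_filter] using hV (hvV i)
  have huinj : Function.Injective u := fun i j h => eu.symm.injective (Subtype.ext h)
  have hvinj : Function.Injective v := fun i j h => ev.symm.injective (Subtype.ext h)
  let T : Finset ℕ := n.primeFactors \ ({2} ∪ (U ∪ V))
  have hTc : n.primeFactors.card ≤ T.card + 7 := by
    have h1 := Finset.le_card_sdiff ({2} ∪ (U ∪ V)) n.primeFactors
    have h2 : ({2} ∪ (U ∪ V) : Finset ℕ).card ≤ 7 := by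
      refine (Finset.card_union_le _ _).trans ?_
      have := Finset.card_union_le U V
      simp
      omega
    change _ ≤ T.card at h1
    omega
  let E : (T → X7) → Fin 3 → Finset ℕ := fun φ i => (Finset.univ.filter (fun p : T => (φ p).1 i = true)).map ⟨Subtype.val, Subtype.val_injective⟩
  have hE : ∀ φ i p, p ∈ E φ i ↔ ∃ h : p ∈ T, (φ ⟨p, h⟩).1 i = true := by
    intro φ i p
    simp [E]
  have hET : ∀ φ i, E φ i ⊆ T := fun φ i p hp => ((hE φ i p).1 hp).1
  let r : Fin 3 → ℕ := ![3, 1, 1]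
  have hodd : ∀ φ i, (∏ p ∈ E φ i, p) % 2 = 1 := by
    intro φ i
    rw [← Nat.odd_iff]
    apply Finset.prod_induction _ Odd (fun _ _ => Odd.mul) odd_one
    intro p hp
    have := hET φ i hp
    simp only [T, Finset.mem_sdiff, Finset.mem_union, Finset.mem_singleton, not_or] at this
    exact (Nat.prime_of_mem_primeFactors this.1).odd_of_ne_two this.2.1
  have hW : ∀ φ i, ∃ W : Finset ℕ, W ⊆ {u i, v i} ∧ ((∏ p ∈ E φ i, p) * ∏ p ∈ W, p) % 8 = r i := by
    intro φ i
    apply fix_res _ (hu i).2 (hv i).2 _ _ (hodd φ i)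
    · fin_cases i <;> simp [r]
    · fin_cases i <;> simp [r]
    · intro h
      have := (hu i).2
      have := (hv i).2
      omega
  choose W hWs hWr using hW
  have hWUV : ∀ φ i p, p ∈ W φ i → p ∈ U ∪ V := by
    intro φ i p hp
    have := hWs φ i hp
    simp only [Finset.mem_insert, Finset.mem_singleton] at this
    rcases this with rfl | rfl
    · exact Finset.mem_union_left _ (huU i)
    · exact Finset.mem_union_right _ (hvV i)
  have hTUV : ∀ p ∈ T, p ∉ U ∪ V := by
    intro p hp h
    simp only [T, Finset.mem_sdiff, Finset.mem_union, Finset.mem_singleton, not_or] at hp h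
    tauto
  let A : (T → X7) → Fin 3 → Finset ℕ := fun φ i => E φ i ∪ W φ i
  have hprod : ∀ φ i, (∏ p ∈ A φ i, p) % 8 = r i := by
    intro φ i
    rw [← hWr φ i, Finset.prod_union]
    rw [Finset.disjoint_left]
    intro p hp hp'
    exact hTUV p (hET φ i hp) (hWUV φ i p hp')
  have hAdm : ∀ φ, Adm n (A φ) := by
    intro φ
    refine ⟨?_, hprod φ 0, hprod φ 1, hprod φ 2, ?_⟩
    · intro i p hp
      rcases Finset.mem_union.1 hp with h | h
      · exact (Finset.mem_sdiff.1 (hET φ i h)).1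
      · have := hWs φ i h
        simp only [Finset.mem_insert, Finset.mem_singleton] at this
        rcases this with rfl | rfl
        · exact (hu i).1
        · exact (hv i).1
    · intro p hp
      by_cases hpT : p ∈ T
      · apply (φ ⟨p, hpT⟩).2
        funext i
        rcases Finset.mem_union.1 (hp i) with h | h
        · exact ((hE φ i p).1 h).2
        · exact absurd (hWUV φ i p h) (hTUV p hpT)
      · have hh : ∀ i, p = u i ∨ p = v i := by
          intro i
          rcases Finset.mem_union.1 (hp i) with h | h
          · exact absurd (hET φ i h) hpT
          · simpa using hWs φ i h
        have a0 := hu 0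
        have a1 := hu 1
        have b0 := hv 0
        have b1 := hv 1
        rcases hh 0 with h | h <;> rcases hh 1 with h' | h'
        · exact absurd (huinj (h.symm.trans h')) (by decide)
        · rw [← h] at a0; rw [← h'] at b1; omega
        · rw [← h] at b0; rw [← h'] at a1; omega
        · exact absurd (hvinj (h.symm.trans h')) (by decide)
  have hAinj : Function.Injective A := by
    intro φ ψ h
    funext ⟨p, hp⟩
    apply Subtype.ext
    funext i
    have key : ∀ χ, p ∈ A χ i ↔ (χ ⟨p, hp⟩).1 i = true := by
      intro χ
      constructor
      · intro h
        rcases Finset.mem_union.1 h with h | h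
        · exact ((hE χ i p).1 h).2
        · exact absurd (hWUV χ i p h) (hTUV p hp)
      · intro h
        exact Finset.mem_union_left _ ((hE χ i p).2 ⟨hp, h⟩)
    have h1 := key φ
    rw [h, key ψ] at h1
    exact Bool.eq_iff_iff.2 h1.symm
  obtain ⟨hfin, hcard⟩ := ordSol_card hn
  have : Finite (OrdSol n) := hfin
  let F : (T → X7) → OrdSol n := fun φ => ⟨sol n (A φ), (hAdm φ).mem hn⟩
  have hF : Function.Injective F := by
    intro φ ψ h
    exact hAinj (sol_inj hn (hAdm φ) (hAdm ψ) (congrArg Subtype.val h))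
  have hle := Nat.card_le_card_of_injective F hF
  have h7 : Fintype.card X7 = 7 := by decide
  rw [Nat.card_eq_fintype_card, Fintype.card_fun, h7, Fintype.card_coe] at hle
  have hle2 : 7 ^ T.card ≤ 6 * numSols 3 4 n := hle.trans hcard
  calc 7 ^ n.primeFactors.card ≤ 7 ^ (T.card + 7) := Nat.pow_le_pow_right (by norm_num) hTc
    _ = 7 ^ 7 * 7 ^ T.card := by ring
    _ ≤ 7 ^ 7 * (6 * numSols 3 4 n) := Nat.mul_le_mul_left _ hle2
    _ ≤ 7 ^ 8 * numSols 3 4 n := by omega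

lemma dirichlet_div {q : ℕ} [NeZero q] (a : ZMod q) (ha : IsUnit a) :
    ¬ Summable (fun n : ℕ => if n.Prime ∧ (n : ZMod q) = a then (1 : ℝ) / n else 0) := by
  intro H
  obtain ⟨C, hC⟩ := ArithmeticFunction.vonMangoldt.LSeries_residueClass_lower_bound ha
  have Hn := ArithmeticFunction.vonMangoldt.summable_residueClass_non_primes_div a
  set R := ArithmeticFunction.vonMangoldt.residueClass a with hR
  have hR0 : ∀ n, 0 ≤ R n := ArithmeticFunction.vonMangoldt.residueClass_nonneg a
  have hlim : Filter.Tendsto (fun x : ℝ => ∑' n : ℕ, (x - 1) * (R n / (n : ℝ) ^ x))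
      (nhdsWithin 1 (Set.Ioi 1)) (nhds (∑' _ : ℕ, (0 : ℝ))) := by
    refine tendsto_tsum_of_dominated_convergence (H.add Hn) ?_ ?_
    · intro n
      rcases Nat.eq_zero_or_pos n with rfl | hn
      · simp [hR]
      · have hn' : (0 : ℝ) < n := by exact_mod_cast hn
        have : ContinuousAt (fun x : ℝ => (x - 1) * (R n / (n : ℝ) ^ x)) 1 := by
          refine ContinuousAt.mul (by fun_prop) (ContinuousAt.div (by fun_prop) ?_ ?_)
          · exact Real.continuousAt_const_rpow hn'.ne'
          · positivity
        have h2 := this.tendsto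
        simp only [sub_self, zero_mul] at h2
        exact h2.mono_left nhdsWithin_le_nhds
    · have : Set.Ioc (1 : ℝ) 2 ∈ nhdsWithin (1 : ℝ) (Set.Ioi 1) := Ioc_mem_nhdsGT (by norm_num)
      filter_upwards [this] with x hx n
      have hx1 : 0 < x - 1 := by linarith [hx.1]
      rcases Nat.eq_zero_or_pos n with rfl | hn
      · simp [hR]
      have hn' : (0 : ℝ) < n := by exact_mod_cast hn
      have hn1 : (1 : ℝ) ≤ n := by exact_mod_cast hn
      have hpow : (n : ℝ) ^ x = n * (n : ℝ) ^ (x - 1) := by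
        rw [Real.rpow_sub_one hn'.ne']; field_simp
      have hpow1 : 1 ≤ (n : ℝ) ^ (x - 1) := Real.one_le_rpow hn1 hx1.le
      have hRn := hR0 n
      rw [Real.norm_of_nonneg (by positivity), hpow]
      by_cases hp : n.Prime
      · simp only [hp, true_and, if_true, zero_div, add_zero]
        by_cases hna : (n : ZMod q) = a
        · simp only [hna, if_true]
          have hRv : R n = Real.log n := by
            simp [hR, ArithmeticFunction.vonMangoldt.residueClass, hna,
              ArithmeticFunction.vonMangoldt_apply_prime hp]
          rw [hRv]
          have hlog : (x - 1) * Real.log n ≤ (n : ℝ) ^ (x - 1) := by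
            rw [← Real.log_rpow hn']
            exact (Real.log_le_sub_one_of_pos (by positivity)).trans (by linarith)
          calc (x - 1) * (Real.log n / (n * (n : ℝ) ^ (x - 1)))
              = ((x - 1) * Real.log n) / (n : ℝ) ^ (x - 1) * (1 / n) := by field_simp
            _ ≤ 1 * (1 / n) := by
                gcongr
                exact (div_le_one (by positivity)).2 hlog
            _ = 1 / n := one_mul _
        · have hRv : R n = 0 := by
            simp [hR, ArithmeticFunction.vonMangoldt.residueClass, hna]
          simp [hRv, hna]
      · simp only [hp, false_and, if_false, zero_add]
        calc (x - 1) * (R n / (n * (n : ℝ) ^ (x - 1))) ≤ 1 * (R n / (n * 1)) := by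
              gcongr
              linarith [hx.2]
          _ = R n / n := by simp
  rw [tsum_zero] at hlim
  have hlow : Filter.Tendsto (fun x : ℝ => (q.totient : ℝ)⁻¹ - C * (x - 1))
      (nhdsWithin 1 (Set.Ioi 1)) (nhds ((q.totient : ℝ)⁻¹ - C * (1 - 1))) := by
    apply Filter.Tendsto.mono_left _ nhdsWithin_le_nhds
    apply Continuous.tendsto (by fun_prop)
  have hle : (q.totient : ℝ)⁻¹ - C * (1 - 1) ≤ 0 := by
    refine le_of_tendsto_of_tendsto hlow hlim ?_
    have : Set.Ioc (1 : ℝ) 2 ∈ nhdsWithin (1 : ℝ) (Set.Ioi 1) := Ioc_mem_nhdsGT (by norm_num)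
    filter_upwards [this] with x hx
    have hx1 : 0 < x - 1 := by linarith [hx.1]
    have h1 := hC hx
    rw [tsum_mul_left]
    have h2 := mul_le_mul_of_nonneg_left h1 hx1.le
    have h3 : (x - 1) * ((q.totient : ℝ)⁻¹ / (x - 1) - C) = (q.totient : ℝ)⁻¹ - C * (x - 1) := by
      have := hx1.ne'
      field_simp
    linarith
  have hq : 0 < (q.totient : ℝ)⁻¹ := inv_pos.mpr (mod_cast q.totient.pos_of_neZero)
  linarith

/-- primes up to `N` satisfying `P` -/
def PS (P : ℕ → Prop) [DecidablePred P] (N : ℕ) : Finset ℕ :=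
  (Finset.range (N + 1)).filter (fun p => p.Prime ∧ P p)

noncomputable def LL (P : ℕ → Prop) [DecidablePred P] (N : ℕ) : ℝ := ∑ p ∈ PS P N, (1 : ℝ) / p

lemma LL_tendsto (P : ℕ → Prop) [DecidablePred P]
    (h : ¬ Summable (fun n : ℕ => if n.Prime ∧ P n then (1 : ℝ) / n else 0)) :
    Filter.Tendsto (LL P) Filter.atTop Filter.atTop := by
  have h1 := (not_summable_iff_tendsto_nat_atTop_of_nonneg (fun n => by positivity)).1 h
  have h2 := h1.comp (Filter.tendsto_add_atTop_nat 1)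
  refine h2.congr fun N => ?_
  simp [LL, PS, Finset.sum_filter]

lemma LL_class (c : ℕ) (hc : Nat.Coprime c 8) (hc8 : c < 8) :
    Filter.Tendsto (LL (fun p => p % 8 = c)) Filter.atTop Filter.atTop := by
  apply LL_tendsto
  have h := dirichlet_div (q := 8) (c : ZMod 8) ((ZMod.isUnit_iff_coprime c 8).2 hc)
  convert h using 6 with n
  rw [ZMod.natCast_eq_natCast_iff']
  rw [Nat.mod_eq_of_lt hc8]

lemma mertens_lower {N : ℕ} (hN : 2 ≤ N) :
    Real.log (Real.log N) ≤ LL (fun _ => True) N + 1 := by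
  have hN' : (2 : ℝ) ≤ N := by exact_mod_cast hN
  let f : ℕ →* ℝ := ⟨⟨fun n => (n : ℝ)⁻¹, by simp⟩, by intro a b; simp [mul_comm]⟩
  have hf : ∀ n, f n = (n : ℝ)⁻¹ := fun n => rfl
  have hP : PS (fun _ => True) N = (N + 1).primesBelow := by
    ext p; simp [PS, Nat.primesBelow]
  obtain ⟨hs, hsum⟩ := EulerProduct.summable_and_hasSum_smoothNumbers_prod_primesBelow_geometric
    (f := f) (fun {p} hp => by
      have : (1 : ℝ) < p := by exact_mod_cast hp.one_lt
      rw [hf, norm_inv, Real.norm_of_nonneg (by positivity)]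
      exact inv_lt_one_of_one_lt₀ this) (N + 1)
  have h1 : Real.log N ≤ ∏ p ∈ (N + 1).primesBelow, (1 - f p)⁻¹ := by
    have hh : Real.log N ≤ ∑ i ∈ Finset.Icc 1 N, (i : ℝ)⁻¹ := by
      have := log_add_one_le_harmonic N
      rw [harmonic_eq_sum_Icc] at this
      push_cast at this
      refine le_trans (Real.log_le_log (by linarith) (by linarith)) this
    refine hh.trans ?_
    let g : ℕ → (N + 1).smoothNumbers := fun i =>
      if h : 0 < i ∧ i < N + 1 then ⟨i, Nat.mem_smoothNumbers_of_lt h.1 h.2⟩ else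
        ⟨1, Nat.mem_smoothNumbers_of_lt (by omega) (by omega)⟩
    have hg : ∀ i ∈ Finset.Icc 1 N, (g i : ℕ) = i := by
      intro i hi
      rw [Finset.mem_Icc] at hi
      have : 0 < i ∧ i < N + 1 := by omega
      simp only [g]; rw [dif_pos this]
    have hinj : Set.InjOn g (Finset.Icc 1 N) := by
      intro i hi j hj h
      rw [← hg i hi, ← hg j hj, h]
    calc ∑ i ∈ Finset.Icc 1 N, (i : ℝ)⁻¹ = ∑ i ∈ Finset.Icc 1 N, f (g i) := by
          refine Finset.sum_congr rfl fun i hi => ?_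
          rw [hg i hi, hf]
      _ = ∑ m ∈ (Finset.Icc 1 N).image g, f m := by
          rw [Finset.sum_image hinj]
      _ ≤ _ := sum_le_hasSum _ (fun m _ => by rw [hf]; positivity) hsum
  have hlogpos : 0 < Real.log N := Real.log_pos (by linarith)
  have hpr : ∀ p ∈ (N + 1).primesBelow, (2 : ℝ) ≤ p := fun p hp => by
    exact_mod_cast (Nat.prime_of_mem_primesBelow hp).two_le
  have h2 : Real.log (Real.log N) ≤ ∑ p ∈ (N + 1).primesBelow, Real.log ((1 - f p)⁻¹) := by
    rw [← Real.log_prod]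
    · exact Real.log_le_log hlogpos h1
    · intro p hp
      have := hpr p hp
      have h3 : (p : ℝ)⁻¹ < 1 := inv_lt_one_of_one_lt₀ (by linarith)
      rw [hf]
      have : 0 < 1 - (p : ℝ)⁻¹ := by linarith
      positivity
  have h3 : ∀ p ∈ (N + 1).primesBelow, Real.log ((1 - f p)⁻¹) ≤
      1 / (p : ℝ) + (1 / ((p : ℝ) - 1) - 1 / p) := by
    intro p hp
    have := hpr p hp
    have h3 : (p : ℝ)⁻¹ < 1 := inv_lt_one_of_one_lt₀ (by linarith)
    have h4 : 0 < 1 - (p : ℝ)⁻¹ := by linarith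
    rw [hf]
    refine (Real.log_le_sub_one_of_pos (by positivity)).trans (le_of_eq ?_)
    have : (p : ℝ) - 1 ≠ 0 := by linarith
    have : (p : ℝ) ≠ 0 := by linarith
    have e : 1 - (p : ℝ)⁻¹ = (p - 1) / p := by field_simp
    rw [e]
    field_simp
    ring
  have h4 : ∑ p ∈ (N + 1).primesBelow, (1 / ((p : ℝ) - 1) - 1 / p) ≤ 1 := by
    calc _ ≤ ∑ p ∈ Finset.Ico 2 (N + 1), (1 / ((p : ℝ) - 1) - 1 / p) := by
          apply Finset.sum_le_sum_of_subset_of_nonneg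
          · intro p hp
            have := (Nat.prime_of_mem_primesBelow hp).two_le
            have := Nat.lt_of_mem_primesBelow hp
            simp; omega
          · intro p hp _
            have : (2 : ℝ) ≤ p := by exact_mod_cast (Finset.mem_Ico.1 hp).1
            rw [sub_nonneg]
            apply one_div_le_one_div_of_le <;> linarith
      _ = 1 - 1 / N := by
          clear * - hN
          induction N, hN using Nat.le_induction with
          | base => norm_num
          | succ n hn ih =>
            rw [Finset.sum_Ico_succ_top (by omega), ih]
            push_cast
            ring
      _ ≤ 1 := by
          have : (0 : ℝ) ≤ 1 / N := by positivity
          linarith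
  have h5 := h2.trans (Finset.sum_le_sum h3)
  rw [Finset.sum_add_distrib] at h5
  rw [LL, hP]
  linarith

lemma LL_all : Filter.Tendsto (LL (fun _ => True)) Filter.atTop Filter.atTop := by
  apply LL_tendsto
  have := not_summable_one_div_on_primes
  convert this using 3 with n
  simp [Set.indicator_apply]

/-- number of elements of `S` dividing `n` -/
def om (S : Finset ℕ) (n : ℕ) : ℕ := (S.filter (· ∣ n)).card

lemma turan (S : Finset ℕ) (N : ℕ) (hS : ∀ p ∈ S, p.Prime) (hc : S.card ≤ N) :
    ∑ n ∈ Finset.Ioc 0 N, ((om S n : ℝ) - ∑ p ∈ S, (1 : ℝ) / p) ^ 2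
      ≤ 3 * N * ∑ p ∈ S, (1 : ℝ) / p := by
  set L := ∑ p ∈ S, (1 : ℝ) / p with hL
  have hL0 : 0 ≤ L := Finset.sum_nonneg fun p _ => by positivity
  have hom : ∀ n, (om S n : ℝ) = ∑ p ∈ S, if p ∣ n then (1 : ℝ) else 0 := by
    intro n; simp [om]
  have hcount : ∀ d : ℕ, ∑ n ∈ Finset.Ioc 0 N, (if d ∣ n then (1 : ℝ) else 0) = ((N / d : ℕ) : ℝ) := by
    intro d
    rw [← Nat.Ioc_filter_dvd_card_eq_div N d]; simp
  have hdivle : ∀ d : ℕ, ((N / d : ℕ) : ℝ) ≤ N * (1 / d) := by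
    intro d; rw [mul_one_div]; exact Nat.cast_div_le
  have h1 : N * L - N ≤ ∑ n ∈ Finset.Ioc 0 N, (om S n : ℝ) := by
    simp_rw [hom]
    rw [Finset.sum_comm]
    simp_rw [hcount]
    have : ∀ p ∈ S, (N : ℝ) * (1 / p) - 1 ≤ ((N / p : ℕ) : ℝ) := by
      intro p hp
      have hp0 : 0 < p := (hS p hp).pos
      have h2 := Nat.lt_div_mul_add (a := N) hp0
      have h3 : (N : ℝ) < (N / p : ℕ) * p + p := by exact_mod_cast h2
      have hp' : (0 : ℝ) < p := by exact_mod_cast hp0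
      rw [mul_one_div, sub_le_iff_le_add, div_le_iff₀ hp']
      linarith
    have h2 := Finset.sum_le_sum this
    rw [Finset.sum_sub_distrib, ← Finset.mul_sum, ← hL] at h2
    have h3 : (S.card : ℝ) ≤ N := by exact_mod_cast hc
    simp at h2
    linarith
  have h2 : ∑ n ∈ Finset.Ioc 0 N, (om S n : ℝ) ^ 2 ≤ N * L + N * L ^ 2 := by
    have e : ∀ n, (om S n : ℝ) ^ 2 = ∑ p ∈ S, ∑ r ∈ S, (if p ∣ n then (1 : ℝ) else 0) * (if r ∣ n then (1 : ℝ) else 0) := by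
      intro n
      rw [hom, sq, Finset.sum_mul_sum]
    simp_rw [e]
    rw [Finset.sum_comm]
    have : ∀ p ∈ S, ∑ n ∈ Finset.Ioc 0 N, ∑ r ∈ S, (if p ∣ n then (1 : ℝ) else 0) * (if r ∣ n then (1 : ℝ) else 0)
        ≤ N * (1 / p) + N * (1 / p) * L := by
      intro p hp
      rw [Finset.sum_comm]
      have : ∀ r ∈ S, ∑ n ∈ Finset.Ioc 0 N, (if p ∣ n then (1 : ℝ) else 0) * (if r ∣ n then (1 : ℝ) else 0)
          ≤ (if p = r then N * (1 / (p : ℝ)) else 0) + N * (1 / p) * (1 / r) := by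
        intro r hr
        by_cases hpr : p = r
        · subst hpr
          have : ∀ n : ℕ, (if p ∣ n then (1 : ℝ) else 0) * (if p ∣ n then (1 : ℝ) else 0) = if p ∣ n then (1 : ℝ) else 0 := by
            intro n; split_ifs <;> simp
          simp_rw [this, hcount, if_true]
          have := hdivle p
          have : (0 : ℝ) ≤ N * (1 / p) * (1 / p) := by positivity
          linarith
        · have hcop := (Nat.coprime_primes (hS p hp) (hS r hr)).2 hpr
          have : ∀ n : ℕ, (if p ∣ n then (1 : ℝ) else 0) * (if r ∣ n then (1 : ℝ) else 0) = if p * r ∣ n then (1 : ℝ) else 0 := by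
            intro n
            have : p * r ∣ n ↔ p ∣ n ∧ r ∣ n := by
              constructor
              · intro h
                exact ⟨(Dvd.intro _ rfl).trans h, (Dvd.intro_left _ rfl).trans h⟩
              · rintro ⟨ha, hb⟩
                exact hcop.mul_dvd_of_dvd_of_dvd ha hb
            by_cases ha : p ∣ n <;> by_cases hb : r ∣ n <;> simp [this, ha, hb]
          simp_rw [this, hcount, if_neg hpr]
          refine (hdivle _).trans (le_of_eq ?_)
          push_cast
          rw [← one_div_mul_one_div]
          ring
      refine (Finset.sum_le_sum this).trans (le_of_eq ?_)
      rw [Finset.sum_add_distrib, ← Finset.mul_sum, Finset.sum_ite_eq]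
      simp [hp, hL]
    refine (Finset.sum_le_sum this).trans (le_of_eq ?_)
    rw [Finset.sum_add_distrib, ← Finset.sum_mul, ← Finset.mul_sum, ← hL]
    ring
  have h3 : ∑ n ∈ Finset.Ioc 0 N, ((om S n : ℝ) - L) ^ 2 =
      ∑ n ∈ Finset.Ioc 0 N, (om S n : ℝ) ^ 2 - 2 * L * ∑ n ∈ Finset.Ioc 0 N, (om S n : ℝ) + N * L ^ 2 := by
    simp_rw [sub_sq]
    rw [Finset.sum_add_distrib, Finset.sum_sub_distrib, Finset.mul_sum]
    simp
    refine Finset.sum_congr rfl fun n _ => by ring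
  rw [h3]
  nlinarith

open Classical in
lemma bad_tendsto (P : ℕ → Prop) [DecidablePred P]
    (h : Filter.Tendsto (LL P) Filter.atTop Filter.atTop) (c : ℝ) (hc : c < 1) :
    Filter.Tendsto (fun N : ℕ => (((Finset.Ioc 0 N).filter
      (fun n => ¬ (c * LL P N ≤ om (PS P N) n))).card : ℝ) / N) Filter.atTop (nhds 0) := by
  have hlim : Filter.Tendsto (fun N => (3 / (1 - c) ^ 2) / LL P N) Filter.atTop (nhds 0) :=
    Filter.Tendsto.div_atTop tendsto_const_nhds h
  refine tendsto_of_tendsto_of_tendsto_of_le_of_le' tendsto_const_nhds hlim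
    (Filter.Eventually.of_forall fun N => by positivity) ?_
  filter_upwards [h.eventually_gt_atTop 0, Filter.eventually_gt_atTop 0] with N hL hN
  set B := (Finset.Ioc 0 N).filter (fun n => ¬ (c * LL P N ≤ om (PS P N) n)) with hB
  have hN' : (0 : ℝ) < N := by exact_mod_cast hN
  have hcard : (PS P N).card ≤ N := by
    have : PS P N ⊆ Finset.Ioc 0 N := by
      intro p hp
      simp only [PS, Finset.mem_filter, Finset.mem_range] at hp
      have := hp.2.1.pos
      simp; omega
    simpa using Finset.card_le_card this
  have ht := turan (PS P N) N (fun p hp => by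
    simp only [PS, Finset.mem_filter] at hp; exact hp.2.1) hcard
  change _ ≤ 3 * N * LL P N at ht
  have hlow : (B.card : ℝ) * ((1 - c) * LL P N) ^ 2 ≤ ∑ n ∈ Finset.Ioc 0 N, ((om (PS P N) n : ℝ) - LL P N) ^ 2 := by
    rw [← nsmul_eq_mul]
    refine (Finset.card_nsmul_le_sum B (fun n => ((om (PS P N) n : ℝ) - LL P N) ^ 2) _ ?_).trans ?_
    · intro n hn
      have := (Finset.mem_filter.1 hn).2
      push Not at this
      have h1 : 0 ≤ (1 - c) * LL P N := mul_nonneg (by linarith) hL.le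
      rw [← neg_sq ((om (PS P N) n : ℝ) - LL P N)]
      apply pow_le_pow_left₀ h1
      linarith
    · exact Finset.sum_le_sum_of_subset_of_nonneg (Finset.filter_subset _ _) (fun _ _ _ => sq_nonneg _)
  have h1c : 0 < 1 - c := by linarith
  have hfin := hlow.trans ht
  rw [div_le_iff₀ hN', div_div, div_mul_eq_mul_div, le_div_iff₀ (by positivity)]
  have : (B.card : ℝ) * ((1 - c) ^ 2 * LL P N) * LL P N ≤ 3 * N * LL P N := by
    calc _ = (B.card : ℝ) * ((1 - c) * LL P N) ^ 2 := by ring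
      _ ≤ _ := hfin
  exact le_of_mul_le_mul_right this hL

lemma om_eq (P : ℕ → Prop) [DecidablePred P] {n N : ℕ} (hn : 0 < n) (hN : n ≤ N) :
    om (PS P N) n = (n.primeFactors.filter P).card := by
  unfold om
  congr 1
  ext p
  simp only [PS, Finset.mem_filter, Finset.mem_range, Nat.mem_primeFactors]
  constructor
  · rintro ⟨⟨h1, h2, h3⟩, h4⟩
    exact ⟨⟨h2, h4, hn.ne'⟩, h3⟩
  · rintro ⟨⟨h1, h2, h3⟩, h4⟩
    have := Nat.le_of_dvd hn h2
    exact ⟨⟨by omega, h1, h4⟩, h2⟩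

lemma log67 : Real.log 6 ≤ 19 / 20 * Real.log 7 := by
  have h : Real.log ((6 : ℝ) ^ 20) ≤ Real.log ((7 : ℝ) ^ 19) :=
    Real.log_le_log (by positivity) (by norm_num)
  rw [Real.log_pow, Real.log_pow] at h
  push_cast at h
  linarith

lemma good (ε : ℝ) (hε : 0 < ε) : ∀ᶠ N : ℕ in Filter.atTop, ∀ n, 0 < n → n ≤ N →
    19 / 20 * LL (fun _ => True) N ≤ om (PS (fun _ => True) N) n →
    1 / 2 * LL (fun p => p % 8 = 3) N ≤ om (PS (fun p => p % 8 = 3) N) n →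
    1 / 2 * LL (fun p => p % 8 = 5) N ≤ om (PS (fun p => p % 8 = 5) N) n →
    Real.exp ((Real.log 6 - ε) * Real.log (Real.log n)) ≤ (numSols 3 4 n : ℝ) := by
  have hl6 : 0 < Real.log 6 := Real.log_pos (by norm_num)
  have hl7 : 0 < Real.log 7 := Real.log_pos (by norm_num)
  have hε' : 0 < min ε (Real.log 6) := lt_min hε hl6
  have hll : Filter.Tendsto (fun N : ℕ => min ε (Real.log 6) * Real.log (Real.log N))
      Filter.atTop Filter.atTop :=
    (Real.tendsto_log_atTop.comp (Real.tendsto_log_atTop.comp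
      tendsto_natCast_atTop_atTop)).const_mul_atTop hε'
  filter_upwards [(LL_class 3 (by norm_num) (by norm_num)).eventually_ge_atTop 6,
    (LL_class 5 (by norm_num) (by norm_num)).eventually_ge_atTop 6,
    hll.eventually_ge_atTop (9 * Real.log 7), Filter.eventually_ge_atTop 3]
    with N hA hB hC hN n hn hnN h1 h3 h5
  rw [om_eq _ hn hnN] at h1 h3 h5
  have h3' : 3 ≤ (n.primeFactors.filter (fun p => p % 8 = 3)).card := by
    have : (3 : ℝ) ≤ ((n.primeFactors.filter (fun p => p % 8 = 3)).card : ℝ) := by linarith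
    exact_mod_cast this
  have h5' : 3 ≤ (n.primeFactors.filter (fun p => p % 8 = 5)).card := by
    have : (3 : ℝ) ≤ ((n.primeFactors.filter (fun p => p % 8 = 5)).card : ℝ) := by linarith
    exact_mod_cast this
  have hms := many_sols hn h3' h5'
  simp only [Finset.filter_true] at h1
  have hn3 : 3 ≤ n := by
    obtain ⟨p, hp⟩ := Finset.card_pos.1 (by omega : 0 < (n.primeFactors.filter (fun p => p % 8 = 3)).card)
    rw [Finset.mem_filter, Nat.mem_primeFactors] at hp
    have := Nat.le_of_dvd hn hp.1.2.1
    omega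
  have hn3' : (3 : ℝ) ≤ n := by exact_mod_cast hn3
  have hnN' : (n : ℝ) ≤ N := by exact_mod_cast hnN
  have hlogn : 1 ≤ Real.log n := by
    rw [Real.le_log_iff_exp_le (by linarith)]
    linarith [Real.exp_one_lt_d9]
  have hy0 : 0 ≤ Real.log (Real.log n) := Real.log_nonneg hlogn
  have hyY : Real.log (Real.log n) ≤ Real.log (Real.log N) :=
    Real.log_le_log (by linarith) (Real.log_le_log (by linarith) hnN')
  set y := Real.log (Real.log n)
  set Y := Real.log (Real.log N)
  have hmert : Y ≤ LL (fun _ => True) N + 1 := mertens_lower (by omega)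
  set k := n.primeFactors.card
  have e1 : (Real.log 6 - ε) * y ≤ Real.log 6 * Y - min ε (Real.log 6) * Y := by
    have a1 : min ε (Real.log 6) ≤ ε := min_le_left _ _
    have a2 : min ε (Real.log 6) ≤ Real.log 6 := min_le_right _ _
    calc (Real.log 6 - ε) * y ≤ (Real.log 6 - min ε (Real.log 6)) * y :=
          mul_le_mul_of_nonneg_right (by linarith) hy0
      _ ≤ (Real.log 6 - min ε (Real.log 6)) * Y :=
          mul_le_mul_of_nonneg_left hyY (by linarith)
      _ = _ := by ring
  have hY0 : 0 ≤ Y := hy0.trans hyY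
  have e2 : Real.log 6 * Y - Real.log 7 ≤ k * Real.log 7 := by
    have b1 : Real.log 6 * Y ≤ 19 / 20 * Real.log 7 * Y := mul_le_mul_of_nonneg_right log67 hY0
    have b2 : (19 / 20 * (Y - 1)) * Real.log 7 ≤ k * Real.log 7 :=
      mul_le_mul_of_nonneg_right (by linarith) hl7.le
    linarith
  have hms' : (7 : ℝ) ^ k ≤ 7 ^ 8 * (numSols 3 4 n : ℝ) := by exact_mod_cast hms
  have e3 : Real.exp ((Real.log 6 - ε) * y) ≤ Real.exp (k * Real.log 7 - 8 * Real.log 7) :=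
    Real.exp_le_exp.2 (by linarith)
  refine e3.trans ?_
  rw [Real.exp_sub, div_le_iff₀ (Real.exp_pos _)]
  have e4 : ∀ j : ℕ, Real.exp (j * Real.log 7) = 7 ^ j := by
    intro j
    rw [Real.exp_nat_mul, Real.exp_log (by norm_num)]
  have e5 := e4 8
  push_cast at e5
  rw [e4, e5]
  linarith

theorem stmt_9 (ε : ℝ) (hε : 0 < ε) :
    Filter.Tendsto
      (fun x : ℕ =>
        (Nat.card {n : ℕ | 0 < n ∧ n ≤ x ∧
          Real.exp ((Real.log 6 - ε) * Real.log (Real.log n)) ≤ (numSols 3 4 n : ℝ)} : ℝ)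
        / (x : ℝ))
      Filter.atTop (nhds 1) := by
  classical
  have b1 := bad_tendsto _ LL_all (19 / 20) (by norm_num)
  have b2 := bad_tendsto _ (LL_class 3 (by norm_num) (by norm_num)) (1 / 2) (by norm_num)
  have b3 := bad_tendsto _ (LL_class 5 (by norm_num) (by norm_num)) (1 / 2) (by norm_num)
  have hb := (b1.add b2).add b3
  have hlow := hb.const_sub 1
  simp only [add_zero, sub_zero] at hlow
  have hset : ∀ x : ℕ, Nat.card {n : ℕ | 0 < n ∧ n ≤ x ∧
      Real.exp ((Real.log 6 - ε) * Real.log (Real.log n)) ≤ (numSols 3 4 n : ℝ)} =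
      ((Finset.Ioc 0 x).filter (fun n : ℕ =>
        Real.exp ((Real.log 6 - ε) * Real.log (Real.log n)) ≤ (numSols 3 4 n : ℝ))).card := by
    intro x
    rw [Nat.card_coe_set_eq, ← Set.ncard_coe_finset]
    congr 1
    ext n
    simp [and_assoc]
  refine tendsto_of_tendsto_of_tendsto_of_le_of_le' hlow tendsto_const_nhds ?_ ?_
  · filter_upwards [good ε hε, Filter.eventually_gt_atTop 0] with x hx hx0
    have hx' : (0 : ℝ) < x := by exact_mod_cast hx0
    rw [hset]
    set G := (Finset.Ioc 0 x).filter (fun n : ℕ =>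
        Real.exp ((Real.log 6 - ε) * Real.log (Real.log n)) ≤ (numSols 3 4 n : ℝ))
    set B1 := (Finset.Ioc 0 x).filter
      (fun n => ¬ (19 / 20 * LL (fun _ => True) x ≤ om (PS (fun _ => True) x) n))
    set B2 := (Finset.Ioc 0 x).filter
      (fun n => ¬ (1 / 2 * LL (fun p => p % 8 = 3) x ≤ om (PS (fun p => p % 8 = 3) x) n))
    set B3 := (Finset.Ioc 0 x).filter
      (fun n => ¬ (1 / 2 * LL (fun p => p % 8 = 5) x ≤ om (PS (fun p => p % 8 = 5) x) n))
    have hcov : Finset.Ioc 0 x ⊆ G ∪ (B1 ∪ B2 ∪ B3) := by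
      intro n hn
      have hn' := Finset.mem_Ioc.1 hn
      by_contra hc
      simp only [G, B1, B2, B3, Finset.mem_union, Finset.mem_filter, hn, true_and, not_or,
        not_not] at hc
      exact hc.1 (hx n hn'.1 hn'.2 hc.2.1.1 hc.2.1.2 hc.2.2)
    have hcard : x ≤ G.card + (B1.card + B2.card + B3.card) := by
      have c1 := Finset.card_le_card hcov
      have c2 := Finset.card_union_le G (B1 ∪ B2 ∪ B3)
      have c3 := Finset.card_union_le (B1 ∪ B2) B3
      have c4 := Finset.card_union_le B1 B2
      rw [Nat.card_Ioc] at c1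
      omega
    have hcard' : (x : ℝ) ≤ G.card + (B1.card + B2.card + B3.card) := by exact_mod_cast hcard
    rw [← add_div, ← add_div, sub_le_iff_le_add, ← add_div, le_div_iff₀ hx']
    linarith
  · filter_upwards with x
    rw [hset]
    apply div_le_one_of_le₀ _ (by positivity)
    have := Finset.card_filter_le (Finset.Ioc 0 x) (fun n : ℕ =>
        Real.exp ((Real.log 6 - ε) * Real.log (Real.log n)) ≤ (numSols 3 4 n : ℝ))
    rw [Nat.card_Ioc] at this
    exact_mod_cast this
end

section
/- For every pair of positive integers e, f with gcd(e,f) = 1 there exist a constant c > 0 and infinitely many primes p with p ≡ e (mod f) such that f₃(4,p) ≥ c · (log p)^(0.549). -/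
open Complex in
lemma es_cpow_diff {x y : ℝ} (hx : 0 < x) (hxy : x ≤ y) {s : ℂ} (hs : 0 < s.re) :
    ‖(y : ℂ) ^ (-s) - (x : ℂ) ^ (-s)‖ ≤ ‖s‖ * x ^ (-s.re - 1) * (y - x) := by
  have hs0 : -s ≠ 0 := by
    intro h
    have : s = 0 := by simpa using h
    simp [this] at hs
  refine norm_image_sub_le_of_norm_deriv_le_segment' (f := fun t : ℝ => (t : ℂ) ^ (-s))
    (f' := fun t : ℝ => (-s) * (t : ℂ) ^ (-s - 1)) (a := x) (b := y) ?_ ?_ y ⟨hxy, le_rfl⟩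
  · intro t ht
    exact (hasDerivAt_ofReal_cpow_const (by linarith [ht.1] : 0 < t).ne'
      hs0).hasDerivWithinAt
  · intro t ht
    have ht0 : 0 < t := lt_of_lt_of_le hx ht.1
    rw [norm_mul, norm_neg, Complex.norm_cpow_eq_rpow_re_of_pos ht0]
    gcongr
    simp only [sub_re, neg_re, one_re]
    exact Real.rpow_le_rpow_of_nonpos hx ht.1 (by linarith)

/-- block of the Dirichlet series -/
noncomputable def esBlock {N : ℕ} [NeZero N] (χ : DirichletCharacter ℂ N) (m : ℕ) (s : ℂ) : ℂ :=
  ∑ j : ZMod N, χ j * ((j.val + N * m : ℕ) : ℂ) ^ (-s)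

lemma esBlock_norm {N : ℕ} [NeZero N] (χ : DirichletCharacter ℂ N) (hχ : χ ≠ 1) (m : ℕ) {s : ℂ}
    (hs : 1 / 2 ≤ s.re) :
    ‖esBlock χ (m + 1) s‖ ≤ ‖s‖ * (N : ℝ) ^ (1 - s.re) * ((m + 1 : ℕ) : ℝ) ^ (-(3 / 2) : ℝ) := by
  have hN : 0 < N := Nat.pos_of_neZero N
  have hN' : (0 : ℝ) < N := by exact_mod_cast hN
  have h1 : esBlock χ (m + 1) s = ∑ j : ZMod N, χ j *
      (((j.val + N * (m + 1) : ℕ) : ℂ) ^ (-s) - ((N * (m + 1) : ℕ) : ℂ) ^ (-s)) := by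
    simp only [mul_sub, Finset.sum_sub_distrib, ← Finset.sum_mul,
      MulChar.sum_eq_zero_of_ne_one hχ, zero_mul, sub_zero]
    rfl
  rw [h1]
  have h2 : ∀ j : ZMod N, ‖χ j * (((j.val + N * (m + 1) : ℕ) : ℂ) ^ (-s) -
      ((N * (m + 1) : ℕ) : ℂ) ^ (-s))‖ ≤
      ‖s‖ * (N : ℝ) ^ (-s.re) * ((m + 1 : ℕ) : ℝ) ^ (-(3 / 2) : ℝ) := by
    intro j
    have hx : (0 : ℝ) < ((N * (m + 1) : ℕ) : ℝ) := by positivity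
    have hd := es_cpow_diff (x := ((N * (m + 1) : ℕ) : ℝ))
      (y := ((j.val + N * (m + 1) : ℕ) : ℝ)) hx (by push_cast; linarith [Nat.cast_nonneg (α := ℝ) j.val])
      (s := s) (by linarith)
    have hj : (j.val : ℝ) ≤ N := by exact_mod_cast (ZMod.val_lt j).le
    rw [norm_mul]
    calc _ ≤ 1 * (‖s‖ * ((N * (m + 1) : ℕ) : ℝ) ^ (-s.re - 1) * N) := by
          gcongr
          · exact DirichletCharacter.norm_le_one χ j
          · refine le_trans (by simpa only [Complex.ofReal_natCast] using hd) ?_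
            gcongr
            push_cast
            linarith
      _ = ‖s‖ * ((N : ℝ) ^ (-s.re - 1) * N) * ((m + 1 : ℕ) : ℝ) ^ (-s.re - 1) := by
          rw [Nat.cast_mul, Real.mul_rpow (by positivity) (by positivity)]
          ring
      _ = ‖s‖ * ((N : ℝ) ^ (-s.re)) * ((m + 1 : ℕ) : ℝ) ^ (-s.re - 1) := by
          rw [← Real.rpow_add_one hN'.ne']; congr 3; ring
      _ ≤ _ := by
          gcongr
          · push_cast; linarith [Nat.cast_nonneg (α := ℝ) m]
          · linarith
  refine (norm_sum_le_of_le _ (fun j _ => h2 j)).trans ?_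
  rw [Finset.sum_const, Finset.card_univ, ZMod.card, nsmul_eq_mul]
  rw [show (1 - s.re) = -s.re + 1 by ring, Real.rpow_add_one hN'.ne']
  apply le_of_eq; ring

lemma esBlock_diff {N : ℕ} [NeZero N] (χ : DirichletCharacter ℂ N) (m : ℕ) (hm : m ≠ 0) :
    Differentiable ℂ (esBlock χ m) := by
  unfold esBlock
  have hN : N ≠ 0 := NeZero.ne N
  intro s
  refine DifferentiableAt.fun_sum fun j _ => ?_
  refine DifferentiableAt.const_mul ?_ _
  refine DifferentiableAt.const_cpow (by fun_prop) (Or.inl ?_)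
  have : (j.val + N * m) ≠ 0 := by positivity
  exact_mod_cast this

lemma es_summable : Summable (fun m : ℕ => ((m + 1 : ℕ) : ℝ) ^ (-(3 / 2) : ℝ)) :=
  (summable_nat_add_iff (f := fun n : ℕ => (n : ℝ) ^ (-(3 / 2) : ℝ)) 1).2
    (Real.summable_nat_rpow.2 (by norm_num))

lemma esBlock_zero_diff {N : ℕ} [NeZero N] (χ : DirichletCharacter ℂ N) (hχ : χ ≠ 1) {s : ℂ} :
    DifferentiableAt ℂ (esBlock χ 0) s := by
  unfold esBlock
  refine DifferentiableAt.fun_sum fun j _ => ?_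
  by_cases hj : j = 0
  · have hN1 : N ≠ 1 := by
      rintro rfl
      exact hχ (Subsingleton.elim _ _)
    have : Fact (1 < N) := ⟨by have := NeZero.ne N; omega⟩
    have : χ j = 0 := by rw [hj]; exact χ.map_nonunit not_isUnit_zero
    simp [this]
  · refine DifferentiableAt.const_mul ?_ _
    refine DifferentiableAt.const_cpow (by fun_prop) (Or.inl ?_)
    have : j.val ≠ 0 := by rwa [Ne, ZMod.val_eq_zero]
    have h2 : j.val + N * 0 ≠ 0 := by omega
    exact_mod_cast h2

lemma es_L_eq {N : ℕ} [NeZero N] (χ : DirichletCharacter ℂ N) (hχ : χ ≠ 1) {s : ℂ}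
    (hs : 1 / 2 < s.re) (hs3 : ‖s‖ < 3) :
    χ.LFunction s = esBlock χ 0 s + ∑' m, esBlock χ (m + 1) s := by
  set U : Set ℂ := {s : ℂ | 1 / 2 < s.re} ∩ Metric.ball 0 3 with hU
  have hUo : IsOpen U := (isOpen_lt continuous_const Complex.continuous_re).inter Metric.isOpen_ball
  have hUc : IsPreconnected U :=
    ((convex_halfSpace_re_gt (1 / 2)).inter (convex_ball 0 3)).isPreconnected
  have hsum : DifferentiableOn ℂ (fun s => ∑' m, esBlock χ (m + 1) s) U := by
    refine Complex.differentiableOn_tsum_of_summable_norm (u := fun m : ℕ => (3 * (N : ℝ)) *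
      ((m + 1 : ℕ) : ℝ) ^ (-(3 / 2) : ℝ)) (es_summable.mul_left _) ?_ hUo ?_
    · intro m
      exact (esBlock_diff χ (m + 1) (by omega)).differentiableOn
    · intro m w hw
      have hw1 : 1 / 2 < w.re := hw.1
      have hw2 : ‖w‖ < 3 := by simpa using hw.2
      refine (esBlock_norm χ hχ m hw1.le).trans ?_
      have hN1 : (1 : ℝ) ≤ N := by exact_mod_cast Nat.pos_of_neZero N
      gcongr
      calc (N : ℝ) ^ (1 - w.re) ≤ (N : ℝ) ^ (1 : ℝ) :=
            Real.rpow_le_rpow_of_exponent_le hN1 (by linarith)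
        _ = N := Real.rpow_one _
  have h2 : DifferentiableOn ℂ (fun s => esBlock χ 0 s + ∑' m, esBlock χ (m + 1) s) U := by
    intro w hw
    exact ((esBlock_zero_diff χ hχ).differentiableWithinAt).add (hsum w hw)
  have key : Set.EqOn χ.LFunction (fun s => esBlock χ 0 s + ∑' m, esBlock χ (m + 1) s) U := by
    refine AnalyticOnNhd.eqOn_of_preconnected_of_eventuallyEq
      ((DirichletCharacter.differentiable_LFunction hχ).differentiableOn.analyticOnNhd hUo)
      (h2.analyticOnNhd hUo) hUc (z₀ := 2) ?_ ?_
    · constructor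
      · simp; norm_num
      · simp; norm_num
    · have : {s : ℂ | 1 < s.re} ∈ nhds (2 : ℂ) :=
        (isOpen_lt continuous_const Complex.continuous_re).mem_nhds (by simp)
      filter_upwards [this] with w hw
      have hw1 : 1 < w.re := hw
      rw [χ.LFunction_eq_LSeries hw1]
      have hS := DirichletCharacter.LSeriesSummable_of_one_lt_re χ hw1
      have hT : LSeries.term (fun n : ℕ => χ n) w = fun n : ℕ => χ n * (n : ℂ) ^ (-w) := by
        funext n
        rw [LSeries.term_def]
        split_ifs with h
        · have : -w ≠ 0 := by
            intro h; have : w = 0 := by simpa using h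
            simp [this] at hw1; linarith
          simp [h, Complex.zero_cpow this]
        · rw [Complex.cpow_neg]; rfl
      unfold LSeriesSummable at hS
      rw [hT] at hS
      have hsm : ∀ j : ZMod N, Summable (fun m : ℕ => χ ((j.val + N * m : ℕ) : ZMod N) *
          ((j.val + N * m : ℕ) : ℂ) ^ (-w)) := by
        intro j
        refine hS.comp_injective (i := fun m : ℕ => j.val + N * m) ?_
        intro a b hab
        have : N * a = N * b := by simpa using hab
        exact Nat.eq_of_mul_eq_mul_left (Nat.pos_of_neZero N) this
      have e1 : LSeries (fun n : ℕ => χ n) w = ∑' m, esBlock χ m w := by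
        unfold LSeries
        rw [hT, Nat.sumByResidueClasses hS N, ← Summable.tsum_finsetSum (fun j _ => hsm j)]
        refine tsum_congr fun m => ?_
        unfold esBlock
        refine Finset.sum_congr rfl fun j _ => ?_
        congr 2
        simp
      have hsb : Summable (fun m => esBlock χ m w) := by
        have := summable_sum (s := Finset.univ) (fun j _ => hsm j)
        refine this.congr fun m => ?_
        unfold esBlock
        refine Finset.sum_congr rfl fun j _ => ?_
        congr 2
        simp
      rw [e1, hsb.tsum_eq_zero_add]
  exact key ⟨hs, by simpa using hs3⟩

lemma es_L_bound (q : ℕ) (hq : 2 ≤ q) : ∃ C : ℝ, 1 ≤ C ∧ ∀ k N : ℕ, 3 ≤ k → N = q ^ k → ∀ [NeZero N],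
    ∀ χ : DirichletCharacter ℂ N, χ ≠ 1 → ∀ s : ℂ, ‖s - 1‖ ≤ 1 / k →
    ‖χ.LFunction s‖ ≤ C * k := by
  set S : ℝ := ∑' m : ℕ, ((m + 1 : ℕ) : ℝ) ^ (-(3 / 2) : ℝ) with hS
  have hS0 : 0 ≤ S := tsum_nonneg fun m => by positivity
  have hq1 : (1 : ℝ) ≤ q := by exact_mod_cast (by omega : 1 ≤ q)
  have hlq : 0 ≤ Real.log q := Real.log_nonneg hq1
  refine ⟨q * (1 + Real.log q) + 2 * q * S, ?_, ?_⟩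
  · have : 0 ≤ 2 * q * S := by positivity
    nlinarith
  intro k N hk hN _ χ hχ s hs
  have hk0 : (3 : ℝ) ≤ k := by exact_mod_cast hk
  have hk1 : (1 : ℝ) / k ≤ 1 / 3 := one_div_le_one_div_of_le (by norm_num) hk0
  have hre : |s.re - 1| ≤ 1 / k := by
    have := Complex.abs_re_le_norm (s - 1)
    simp only [Complex.sub_re, Complex.one_re] at this
    linarith
  have hre2 := abs_le.1 hre
  have hs2 : ‖s‖ ≤ 2 := by
    calc ‖s‖ = ‖(s - 1) + 1‖ := by ring_nf
      _ ≤ ‖s - 1‖ + ‖(1 : ℂ)‖ := norm_add_le _ _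
      _ ≤ 2 := by rw [norm_one]; linarith
  rw [es_L_eq χ hχ (by linarith) (by linarith)]
  have hN1 : 1 ≤ N := hN ▸ Nat.one_le_pow _ _ (by omega)
  have hN1' : (1 : ℝ) ≤ N := by exact_mod_cast hN1
  have hNq : (N : ℝ) ^ ((1 : ℝ) / k) = q := by
    rw [hN, Nat.cast_pow, one_div]
    exact Real.pow_rpow_inv_natCast (by positivity) (by omega)
  have hNs : ∀ x : ℝ, x ≤ 1 / k → (N : ℝ) ^ x ≤ q := fun x hx => by
    rw [← hNq]; exact Real.rpow_le_rpow_of_exponent_le hN1' hx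
  have b1 : ‖∑' m, esBlock χ (m + 1) s‖ ≤ 2 * q * S := by
    refine tsum_of_norm_bounded (es_summable.hasSum.mul_left (2 * (q : ℝ))) fun m => ?_
    refine (esBlock_norm χ hχ m (by linarith)).trans ?_
    gcongr
    exact hNs _ (by linarith)
  have b0 : ‖esBlock χ 0 s‖ ≤ q * (1 + k * Real.log q) := by
    have hterm : ∀ j : ZMod N, ‖χ j * ((j.val + N * 0 : ℕ) : ℂ) ^ (-s)‖ ≤ q * ((j.val : ℝ))⁻¹ := by
      intro j
      by_cases hj : j.val = 0
      · rw [hj]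
        have : -s ≠ 0 := by
          intro h; have : s = 0 := by simpa using h
          rw [this, Complex.zero_re] at hre2; linarith
        simp [Complex.zero_cpow this]
      · have hjp : 0 < j.val := Nat.pos_of_ne_zero hj
        have hjp' : (0 : ℝ) < j.val := by exact_mod_cast hjp
        have hj1 : (1 : ℝ) ≤ j.val := by exact_mod_cast hjp
        have hjN : (j.val : ℝ) ≤ N := by exact_mod_cast (ZMod.val_lt j).le
        rw [norm_mul, mul_zero, add_zero, Complex.norm_natCast_cpow_of_pos hjp]
        calc _ ≤ 1 * (j.val : ℝ) ^ (-s).re := by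
              gcongr; exact DirichletCharacter.norm_le_one χ j
          _ = (j.val : ℝ) ^ (1 - s.re) * (j.val : ℝ)⁻¹ := by
              rw [one_mul, ← Real.rpow_neg_one (j.val : ℝ), ← Real.rpow_add hjp']
              congr 1; simp; ring
          _ ≤ _ := by
              gcongr
              calc (j.val : ℝ) ^ (1 - s.re) ≤ (j.val : ℝ) ^ ((1 : ℝ) / k) :=
                    Real.rpow_le_rpow_of_exponent_le hj1 (by linarith)
                _ ≤ (N : ℝ) ^ ((1 : ℝ) / k) := by gcongr
                _ = q := hNq
    unfold esBlock
    refine (norm_sum_le_of_le _ (fun j _ => hterm j)).trans ?_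
    rw [← Finset.mul_sum]
    gcongr
    have e : ∑ j : ZMod N, ((j.val : ℝ))⁻¹ = ∑ n ∈ Finset.range N, (n : ℝ)⁻¹ := by
      refine Finset.sum_bij (fun j _ => j.val) (fun j _ => Finset.mem_range.2 (ZMod.val_lt j))
        (fun a _ b _ h => ZMod.val_injective N h) (fun b hb => ⟨(b : ZMod N), Finset.mem_univ _,
          ZMod.val_cast_of_lt (Finset.mem_range.1 hb)⟩) (fun _ _ => rfl)
    rw [e]
    have h3 := harmonic_le_one_add_log N
    have h4 : ∑ n ∈ Finset.range N, (n : ℝ)⁻¹ ≤ ((harmonic N : ℚ) : ℝ) := by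
      unfold harmonic
      push_cast
      have : ∑ n ∈ Finset.range (N + 1), (n : ℝ)⁻¹ = ∑ n ∈ Finset.range N, ((n : ℝ) + 1)⁻¹ := by
        rw [Finset.sum_range_succ']; simp
      rw [← this, Finset.sum_range_succ]
      have : (0 : ℝ) ≤ (N : ℝ)⁻¹ := by positivity
      linarith
    have h5 : Real.log N = k * Real.log q := by rw [hN]; push_cast; rw [Real.log_pow]
    linarith
  refine (norm_add_le _ _).trans ((add_le_add b0 b1).trans ?_)
  have : 0 ≤ 2 * q * S := by positivity
  have h6 : q * (1 + k * Real.log q) ≤ q * (1 + Real.log q) * k := by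
    have : (1 + k * Real.log q) ≤ (1 + Real.log q) * k := by nlinarith
    nlinarith
  nlinarith

lemma es_real_ker {q h k N : ℕ} (hq : q = 2 * h) (hN : N = q ^ k) [NeZero N]
    (χ : DirichletCharacter ℂ N) (hχ : χ ^ 2 = 1) (i : ℕ) :
    3 + i ≤ k → ∀ t : ZMod N, χ (1 + (q : ZMod N) ^ (k - i) * t) = 1 := by
  have hqk : (q : ZMod N) ^ k = 0 := by
    rw [← Nat.cast_pow, ← hN]; exact ZMod.natCast_self N
  have hqn : IsNilpotent (q : ZMod N) := ⟨k, hqk⟩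
  induction i with
  | zero => intro _ t; simp [hqk]
  | succ i ih =>
    intro hi t
    obtain ⟨j, hj⟩ : ∃ j, k - (i + 1) = j + 3 := ⟨k - (i + 1) - 3, by omega⟩
    have hj2 : k - i = j + 4 := by omega
    have ih' := ih (by omega)
    rw [hj2] at ih'
    rw [hj]
    set y : ZMod N := 1 + (q : ZMod N) ^ (j + 2) * (h * t) with hy
    have hyu : IsUnit y := by
      refine IsNilpotent.isUnit_one_add ?_
      exact (Commute.all _ _).isNilpotent_mul_right (hqn.pow_succ (j + 1))
    obtain ⟨u, hu⟩ := hyu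
    have hq' : (q : ZMod N) = 2 * h := by rw [hq]; push_cast; ring
    have e : 1 + (q : ZMod N) ^ (j + 3) * t =
        y ^ 2 * (1 + (q : ZMod N) ^ (j + 4) * (-(q : ZMod N) ^ j * (h * t) ^ 2 * ((u⁻¹ : (ZMod N)ˣ) : ZMod N) ^ 2)) := by
      have hinv : y ^ 2 * ((u⁻¹ : (ZMod N)ˣ) : ZMod N) ^ 2 = 1 := by
        rw [← hu, ← mul_pow, Units.mul_inv, one_pow]
      have : y ^ 2 * (1 + (q : ZMod N) ^ (j + 4) * (-(q : ZMod N) ^ j * (h * t) ^ 2 * ((u⁻¹ : (ZMod N)ˣ) : ZMod N) ^ 2))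
        = y ^ 2 + (q : ZMod N) ^ (j + 4) * (-(q : ZMod N) ^ j * (h * t) ^ 2) *
          (y ^ 2 * ((u⁻¹ : (ZMod N)ˣ) : ZMod N) ^ 2) := by ring
      rw [this, hinv, hy]
      have e3 : (q : ZMod N) ^ (j + 3) * t = 2 * ((q : ZMod N) ^ (j + 2) * (h * t)) := by
        rw [pow_succ (q : ZMod N) (j + 2)]
        nth_rewrite 2 [hq']
        ring
      rw [e3]; ring
    rw [e, map_mul, ih', mul_one, map_pow, ← hu]
    have := congrArg (fun ψ : DirichletCharacter ℂ N => ψ u) hχ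
    simpa [MulChar.pow_apply_coe] using this

lemma es_real_factor {q k N : ℕ} (hq : 2 ∣ q) (hk : 3 ≤ k) (hN : N = q ^ k) [NeZero N]
    [NeZero (q ^ 3)]
    (χ : DirichletCharacter ℂ N) (hχ : χ ^ 2 = 1) (hχ1 : χ ≠ 1) :
    ∃ ψ : DirichletCharacter ℂ (q ^ 3), ψ ≠ 1 ∧ ∀ s, χ.LFunction s = ψ.LFunction s := by
  obtain ⟨h, hh⟩ := hq
  have hd : q ^ 3 ∣ N := hN ▸ pow_dvd_pow q hk
  have hf : χ.FactorsThrough (q ^ 3) := by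
    rw [DirichletCharacter.factorsThrough_iff_ker_unitsMap hd]
    intro u hu
    rw [MonoidHom.mem_ker] at hu ⊢
    have h1 : ((u : ZMod N).val : ZMod (q ^ 3)) = 1 := by
      have := congrArg (fun v : (ZMod (q ^ 3))ˣ => (v : ZMod (q ^ 3))) hu
      simp only [ZMod.unitsMap_val, Units.val_one] at this
      rw [ZMod.natCast_val]; exact this
    have h2 : (((u : ZMod N).val : ℤ) : ZMod (q ^ 3)) = ((1 : ℤ) : ZMod (q ^ 3)) := by
      simpa using h1
    rw [ZMod.intCast_eq_intCast_iff_dvd_sub] at h2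
    obtain ⟨t, ht⟩ := h2
    have h3 : (u : ZMod N) = 1 + (q : ZMod N) ^ 3 * ((-t : ℤ) : ZMod N) := by
      have : (((u : ZMod N).val : ℤ) : ZMod N) = (((1 : ℤ) + ((q : ℤ) ^ 3) * (-t) : ℤ) : ZMod N) := by
        congr 1; push_cast at ht; linarith
      push_cast at this
      simpa using this
    have h4 := es_real_ker hh hN χ hχ (k - 3) (by omega) ((-t : ℤ) : ZMod N)
    rw [show k - (k - 3) = 3 by omega, ← h3] at h4
    ext
    simpa using h4
  obtain ⟨hd', ψ, hψ⟩ := hf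
  have hψ1 : ψ ≠ 1 := by
    rintro rfl
    exact hχ1 (by rw [hψ]; simp)
  refine ⟨ψ, hψ1, fun s => ?_⟩
  rw [hψ, DirichletCharacter.LFunction_changeLevel hd' ψ (Or.inl hψ1)]
  rw [Finset.prod_eq_one, mul_one]
  intro p hp
  have hpp := Nat.prime_of_mem_primeFactors hp
  have hpq : p ∣ q := by
    have := Nat.dvd_of_mem_primeFactors hp
    rw [hN] at this
    exact hpp.dvd_of_dvd_pow this
  have : ψ (p : ZMod (q ^ 3)) = 0 := by
    refine ψ.map_nonunit ?_
    rw [ZMod.isUnit_iff_coprime, Nat.coprime_pow_right_iff (by norm_num),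
      Nat.Prime.coprime_iff_not_dvd hpp]
    exact fun h => h hpq
  simp [this]

open Filter Topology in
lemma es_fixed_lower (M : ℕ) [NeZero M] : ∃ c : ℝ, 0 < c ∧ ∃ δ : ℝ, 0 < δ ∧
    ∀ ψ : DirichletCharacter ℂ M, ψ ≠ 1 → ∀ s : ℂ, ‖s - 1‖ ≤ δ → c ≤ ‖ψ.LFunction s‖ := by
  have h1 : ∀ ψ : DirichletCharacter ℂ M, ∃ c : ℝ, 0 < c ∧ (ψ ≠ 1 → ∀ᶠ s in 𝓝 (1 : ℂ),
      c ≤ ‖ψ.LFunction s‖) := by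
    intro ψ
    by_cases hψ : ψ = 1
    · exact ⟨1, one_pos, fun h => absurd hψ h⟩
    · have h0 : 0 < ‖ψ.LFunction 1‖ :=
        norm_pos_iff.2 (DirichletCharacter.LFunction_apply_one_ne_zero hψ)
      refine ⟨‖ψ.LFunction 1‖ / 2, by positivity, fun _ => ?_⟩
      have hc : ContinuousAt (fun s => ‖ψ.LFunction s‖) 1 :=
        (DirichletCharacter.differentiable_LFunction hψ).continuous.norm.continuousAt
      exact (hc.eventually_const_lt (by linarith : ‖ψ.LFunction 1‖ / 2 < ‖ψ.LFunction 1‖)).mono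
        fun s hs => hs.le
  choose c hc0 hc using h1
  obtain ⟨ψ0, hψ0⟩ := Finite.exists_min c
  have h2 : ∀ᶠ s in 𝓝 (1 : ℂ), ∀ ψ : DirichletCharacter ℂ M, ψ ≠ 1 → c ψ0 ≤ ‖ψ.LFunction s‖ := by
    rw [eventually_all]
    intro ψ
    by_cases hψ : ψ = 1
    · exact Eventually.of_forall fun s h => absurd hψ h
    · exact (hc ψ hψ).mono fun s hs _ => (hψ0 ψ).trans hs
  obtain ⟨ε, hε, h3⟩ := Metric.eventually_nhds_iff.1 h2
  refine ⟨c ψ0, hc0 ψ0, ε / 2, by positivity, fun ψ hψ s hs => h3 ?_ ψ hψ⟩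
  rw [dist_eq_norm]; linarith

lemma es_triv_eq {q k N : ℕ} (hk : k ≠ 0) (hN : N = q ^ k) [NeZero N] [NeZero q] :
    DirichletCharacter.LFunctionTrivChar₁ N = DirichletCharacter.LFunctionTrivChar₁ q := by
  have hp : N.primeFactors = q.primeFactors := by rw [hN, Nat.primeFactors_pow _ hk]
  funext s
  by_cases hs : s = 1
  · subst hs
    simp [DirichletCharacter.LFunctionTrivChar₁, hp]
  · simp only [DirichletCharacter.LFunctionTrivChar₁, Function.update_of_ne hs]
    rw [DirichletCharacter.LFunctionTrivChar_eq_mul_riemannZeta hs,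
      DirichletCharacter.LFunctionTrivChar_eq_mul_riemannZeta hs, hp]

open Filter Topology in
lemma es_triv_bound (q : ℕ) [NeZero q] : ∃ C : ℝ, 1 ≤ C ∧ ∃ δ : ℝ, 0 < δ ∧ ∀ s : ℂ, ‖s - 1‖ ≤ δ →
    DirichletCharacter.LFunctionTrivChar₁ q s ≠ 0 ∧
    ‖DirichletCharacter.LFunctionTrivChar₁ q s‖ ≤ C ∧
    ‖deriv (DirichletCharacter.LFunctionTrivChar₁ q) s /
      DirichletCharacter.LFunctionTrivChar₁ q s‖ ≤ C := by
  set G := DirichletCharacter.LFunctionTrivChar₁ q with hG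
  have hd : Differentiable ℂ G := DirichletCharacter.differentiable_LFunctionTrivChar₁ q
  have h1 : G 1 ≠ 0 := DirichletCharacter.LFunctionTrivChar₁_apply_one_ne_zero q
  have hc : ContinuousAt G 1 := hd.continuous.continuousAt
  have hc2 : ContinuousAt (fun s => deriv G s / G s) 1 :=
    (hd.contDiff.continuous_deriv le_rfl).continuousAt.div hc h1
  have e1 := hc.eventually_ne h1
  have e2 := hc.norm.eventually_lt_const (by linarith : ‖G 1‖ < ‖G 1‖ + 1)
  have e3 := hc2.norm.eventually_lt_const
    (by linarith : ‖deriv G 1 / G 1‖ < ‖deriv G 1 / G 1‖ + 1)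
  obtain ⟨ε, hε, h3⟩ := Metric.eventually_nhds_iff.1 (e1.and (e2.and e3))
  have n1 := norm_nonneg (G 1)
  have n2 := norm_nonneg (deriv G 1 / G 1)
  refine ⟨‖G 1‖ + ‖deriv G 1 / G 1‖ + 1, by linarith, ε / 2, by positivity, fun s hs => ?_⟩
  obtain ⟨a, b, c⟩ := h3 (y := s) (by rw [dist_eq_norm]; linarith)
  exact ⟨a, by linarith, by linarith⟩

lemma es_zero_free (q : ℕ) [NeZero q] (hq2 : 2 ∣ q) : ∃ c : ℝ, 0 < c ∧ c ≤ 1 / 100 ∧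
    ∀ k N : ℕ, 3 ≤ k → N = q ^ k → ∀ [NeZero N], ∀ η : ℝ, 0 < η → η ≤ c / k ^ 9 →
    ∀ s : ℂ, ‖s - (1 + η)‖ ≤ 4 * η →
    (∀ χ : DirichletCharacter ℂ N, χ ≠ 1 → χ.LFunction s ≠ 0 ∧
      ‖deriv χ.LFunction s / χ.LFunction s‖ ≤ 1 / (4 * η)) ∧
    (DirichletCharacter.LFunctionTrivChar₁ N s ≠ 0 ∧
    ‖deriv (DirichletCharacter.LFunctionTrivChar₁ N) s /
      DirichletCharacter.LFunctionTrivChar₁ N s‖ ≤ 1 / (4 * η)) := by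
  have hq : 2 ≤ q := Nat.le_of_dvd (Nat.pos_of_neZero q) hq2
  obtain ⟨C, hC, hL⟩ := es_L_bound q hq
  obtain ⟨c0, hc0, δ0, hδ0, hR⟩ := es_fixed_lower (q ^ 3)
  obtain ⟨C1, hC1, δ1, hδ1, hT⟩ := es_triv_bound q
  set A : ℝ := 8 * (2 * C) with hA
  set D : ℝ := C1 ^ 3 * C * A ^ 4 with hD
  have hA1 : 0 < A := by positivity
  have hD1 : 0 < D := by positivity
  set c : ℝ := min (min (1 / 100) (δ0 / 5)) (min (min (δ1 / 5) (1 / (2 * D)))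
    (min (c0 / A) (1 / (4 * C1)))) with hc
  have hcpos : 0 < c := by simp only [hc, lt_min_iff]; refine ⟨⟨?_, ?_⟩, ⟨?_, ?_⟩, ?_, ?_⟩ <;> positivity
  have hc1 : c ≤ 1 / 100 := (min_le_left _ _).trans (min_le_left _ _)
  have hc2 : c ≤ δ0 / 5 := (min_le_left _ _).trans (min_le_right _ _)
  have hc3 : c ≤ δ1 / 5 := (min_le_right _ _).trans ((min_le_left _ _).trans (min_le_left _ _))
  have hc4 : c ≤ 1 / (2 * D) := (min_le_right _ _).trans ((min_le_left _ _).trans (min_le_right _ _))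
  have hc5 : c ≤ c0 / A := (min_le_right _ _).trans ((min_le_right _ _).trans (min_le_left _ _))
  have hc6 : c ≤ 1 / (4 * C1) := (min_le_right _ _).trans ((min_le_right _ _).trans (min_le_right _ _))
  refine ⟨c, hcpos, hc1, ?_⟩
  intro k N hk hN _ η hη hηc s hs
  have hk3 : (3 : ℝ) ≤ k := by exact_mod_cast hk
  have hk1 : (1 : ℝ) ≤ k := by linarith
  have hkη : η * k ^ 9 ≤ c := by rwa [le_div_iff₀ (by positivity)] at hηc
  have hkpow : ∀ j : ℕ, j ≤ 9 → η * (k : ℝ) ^ j ≤ c := fun j hj =>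
    le_trans (by gcongr) hkη
  have hηle : η ≤ c := by simpa using hkpow 0 (by norm_num)
  have hnη : ‖(1 + (η : ℂ)) - 1‖ = η := by
    rw [add_sub_cancel_left, Complex.norm_real, Real.norm_of_nonneg hη.le]
  have hball : ∀ w : ℂ, ‖w - (1 + η)‖ ≤ 4 * η → ‖w - 1‖ ≤ 5 * η := by
    intro w hw
    calc ‖w - 1‖ = ‖(w - (1 + η)) + ((1 + (η : ℂ)) - 1)‖ := by ring_nf
      _ ≤ _ := norm_add_le _ _
      _ ≤ 5 * η := by rw [hnη]; linarith
  have h5k : 5 * η ≤ 1 / (2 * k) := by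
    have := hkpow 1 (by norm_num)
    rw [le_div_iff₀ (by positivity)]
    nlinarith
  have hs1 := hball s hs
  constructor
  · intro χ hχ
    have hdiff := DirichletCharacter.differentiable_LFunction hχ
    -- derivative bound
    have hder : ∀ w : ℂ, ‖w - (1 + η)‖ ≤ 4 * η → ‖deriv χ.LFunction w‖ ≤ 2 * C * k ^ 2 := by
      intro w hw
      have := Complex.norm_deriv_le_of_forall_mem_sphere_norm_le (c := w) (R := 1 / (2 * k))
        (C := C * k) (f := χ.LFunction) (by positivity) hdiff.diffContOnCl ?_
      · refine this.trans (le_of_eq ?_)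
        field_simp
      · intro z hz
        refine hL k N hk hN χ hχ z ?_
        have hz' : ‖z - w‖ = 1 / (2 * k) := by simpa [dist_eq_norm] using hz
        calc ‖z - 1‖ = ‖(z - w) + (w - 1)‖ := by ring_nf
          _ ≤ _ := norm_add_le _ _
          _ ≤ 1 / (2 * k) + 1 / (2 * k) := by
            rw [hz']; have := hball w hw; linarith
          _ = 1 / k := by field_simp; norm_num
    -- lower bound at centre
    have hlow : A * k ^ 2 * η ≤ ‖χ.LFunction (1 + η)‖ := by
      by_cases hχ2 : χ ^ 2 = 1
      · have : NeZero (q ^ 3) := inferInstance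
        obtain ⟨ψ, hψ, hψL⟩ := es_real_factor hq2 hk hN χ hχ2 hχ
        rw [hψL]
        refine le_trans ?_ (hR ψ hψ _ (by rw [hnη]; linarith))
        have := (hkpow 2 (by norm_num)).trans hc5
        rw [le_div_iff₀ hA1] at this
        linarith
      · by_contra hcon
        push Not at hcon
        have h341 := DirichletCharacter.norm_LFunction_product_ge_one (N := N) χ hη 0
        simp only [Complex.ofReal_zero, mul_zero, add_zero, norm_mul, norm_pow] at h341
        have b2 : ‖(χ ^ 2).LFunction (1 + η)‖ ≤ C * k := by
          refine hL k N hk hN (χ ^ 2) hχ2 _ ?_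
          rw [hnη]
          have : (1 : ℝ) / (2 * k) ≤ 1 / k := by gcongr; linarith
          linarith
        have b0 : ‖DirichletCharacter.LFunctionTrivChar N (1 + η)‖ ≤ C1 / η := by
          have hne : (1 + (η : ℂ)) ≠ 1 := by
            intro h
            rw [h, sub_self, norm_zero] at hnη
            linarith
          have := (hT (1 + η) (by rw [hnη]; linarith)).2.1
          rw [← es_triv_eq (by omega) hN, DirichletCharacter.LFunctionTrivChar₁,
            Function.update_of_ne hne, norm_mul, hnη] at this
          rw [le_div_iff₀ hη]; linarith
        have : (1 : ℝ) ≤ (C1 / η) ^ 3 * (A * k ^ 2 * η) ^ 4 * (C * k) := by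
          refine h341.le.trans ?_
          gcongr
        have e : (C1 / η) ^ 3 * (A * k ^ 2 * η) ^ 4 * (C * k) = D * (η * k ^ 9) := by
          rw [hD]; field_simp
        rw [e] at this
        have h7 : D * (η * k ^ 9) ≤ D * (1 / (2 * D)) := by gcongr; exact hkη.trans hc4
        have h8 : D * (1 / (2 * D)) = 1 / 2 := by field_simp
        linarith
    have hdev : ‖χ.LFunction s - χ.LFunction (1 + η)‖ ≤ 2 * C * k ^ 2 * (4 * η) := by
      have := Convex.norm_image_sub_le_of_norm_deriv_le (𝕜 := ℂ) (f := χ.LFunction)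
        (s := Metric.closedBall (1 + (η : ℂ)) (4 * η)) (C := 2 * C * k ^ 2)
        (x := 1 + η) (y := s) (fun x _ => hdiff x)
        (fun x hx => hder x (by simpa [dist_eq_norm] using hx)) (convex_closedBall _ _)
        (by simpa using hη.le) (by simpa [dist_eq_norm] using hs)
      refine this.trans ?_
      gcongr
    have hlow2 : A / 2 * k ^ 2 * η ≤ ‖χ.LFunction s‖ := by
      have h9 := norm_sub_norm_le (χ.LFunction (1 + η)) (χ.LFunction s)
      rw [norm_sub_rev] at h9
      have : 2 * C * k ^ 2 * (4 * η) = A / 2 * k ^ 2 * η := by rw [hA]; ring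
      linarith
    have hpos : 0 < A / 2 * k ^ 2 * η := by positivity
    refine ⟨norm_pos_iff.1 (hpos.trans_le hlow2), ?_⟩
    rw [norm_div, div_le_div_iff₀ (hpos.trans_le hlow2) (by positivity)]
    calc ‖deriv χ.LFunction s‖ * (4 * η) ≤ 2 * C * k ^ 2 * (4 * η) := by
          gcongr; exact hder s hs
      _ = A / 2 * k ^ 2 * η := by rw [hA]; ring
      _ ≤ 1 * ‖χ.LFunction s‖ := by linarith
  · rw [es_triv_eq (by omega : k ≠ 0) hN]
    obtain ⟨a, _, b⟩ := hT s (by linarith)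
    refine ⟨a, b.trans ?_⟩
    rw [le_div_iff₀ (by positivity)]
    have := hηle.trans hc6
    rw [le_div_iff₀ (by positivity)] at this
    linarith

lemma es_logMul_iter (f : ℕ → ℂ) (K n : ℕ) :
    (LSeries.logMul^[K] f) n = (Real.log n : ℂ) ^ K * f n := by
  induction K generalizing f with
  | zero => simp
  | succ K ih =>
    rw [Function.iterate_succ_apply, ih]
    simp only [LSeries.logMul, Complex.natCast_log]
    ring

lemma es_iter_inv (K : ℕ) (c z : ℂ) :
    iteratedDeriv K (fun s : ℂ => c / (s - 1)) z =
      c * ((-1) ^ K * (K.factorial : ℂ) * (z - 1) ^ (-1 - (K : ℤ))) := by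
  have h1 : iteratedDeriv K (fun s : ℂ => (s - 1)⁻¹) z =
      (-1) ^ K * (K.factorial : ℂ) * (z - 1) ^ (-1 - (K : ℤ)) := by
    have := congrFun (iteratedDeriv_comp_sub_const K (Inv.inv : ℂ → ℂ) 1) z
    rw [this, iteratedDeriv_eq_iterate, iter_deriv_inv]
  have : (fun s : ℂ => c / (s - 1)) = fun s : ℂ => c * (s - 1)⁻¹ := by
    funext s; rw [div_eq_mul_inv]
  rw [this, iteratedDeriv_const_mul_field, h1]

open ArithmeticFunction.vonMangoldt in
/-- the weighted sum over the residue class -/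
noncomputable def esTerm {N : ℕ} (a : ZMod N) (K : ℕ) (η : ℝ) (n : ℕ) : ℝ :=
  residueClass a n * Real.log n ^ K * (n : ℝ) ^ (-(1 + η))

open ArithmeticFunction.vonMangoldt DirichletCharacter in
lemma es_taylor {N : ℕ} [NeZero N] {a : ZMod N} (ha : IsUnit a) (K : ℕ) {η : ℝ} (hη : 0 < η)
    (H : ∀ s : ℂ, ‖s - (1 + η)‖ ≤ 4 * η →
    (∀ χ : DirichletCharacter ℂ N, χ ≠ 1 → χ.LFunction s ≠ 0 ∧
      ‖deriv χ.LFunction s / χ.LFunction s‖ ≤ 1 / (4 * η)) ∧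
    (DirichletCharacter.LFunctionTrivChar₁ N s ≠ 0 ∧
    ‖deriv (DirichletCharacter.LFunctionTrivChar₁ N) s /
      DirichletCharacter.LFunctionTrivChar₁ N s‖ ≤ 1 / (4 * η))) :
    Summable (esTerm a K η) ∧
    |∑' n, esTerm a K η n - (N.totient : ℝ)⁻¹ * K.factorial / η ^ (K + 1)| ≤
      K.factorial * (1 / (4 * η)) / (4 * η) ^ K := by
  classical
  set f : ℕ → ℂ := fun n => ((residueClass a n : ℝ) : ℂ) with hf
  set s0 : ℂ := 1 + η with hs0
  have hs0re : s0.re = 1 + η := by simp [hs0]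
  have habs : LSeries.abscissaOfAbsConv f < s0.re := by
    refine (abscissaOfAbsConv_residueClass_le_one a).trans_lt ?_
    rw [hs0re]
    exact_mod_cast (by linarith : (1 : ℝ) < 1 + η)
  have hterm : ∀ n, LSeries.term (LSeries.logMul^[K] f) s0 n = ((esTerm a K η n : ℝ) : ℂ) := by
    intro n
    rw [LSeries.term_def]
    split_ifs with h
    · simp [esTerm, h]
    · rw [es_logMul_iter, esTerm]
      push_cast
      rw [Complex.ofReal_cpow (Nat.cast_nonneg n)]
      push_cast
      rw [Complex.cpow_neg, hs0, hf]
      field_simp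
  have hsum : LSeriesSummable (LSeries.logMul^[K] f) s0 :=
    LSeriesSummable_of_abscissaOfAbsConv_lt_re (by rwa [LSeries.absicssaOfAbsConv_logPowMul])
  have hsumm : Summable (esTerm a K η) := by
    unfold LSeriesSummable at hsum
    rw [funext hterm] at hsum
    exact_mod_cast hsum
  refine ⟨hsumm, ?_⟩
  have hLS : LSeries (LSeries.logMul^[K] f) s0 = ((∑' n, esTerm a K η n : ℝ) : ℂ) := by
    rw [LSeries, funext hterm, Complex.ofReal_tsum]
  -- the auxiliary function
  have hcard : ((({1}ᶜ : Finset (DirichletCharacter ℂ N)).card : ℝ)) + 1 = N.totient := by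
    have h1 := card_eq_totient_of_hasEnoughRootsOfUnity ℂ N
    rw [Nat.card_eq_fintype_card] at h1
    rw [Finset.card_compl, Finset.card_singleton, h1]
    have : 1 ≤ N.totient := Nat.totient_pos.2 (Nat.pos_of_neZero N)
    push_cast [Nat.cast_sub this]
    ring
  have hφ : (0 : ℝ) < N.totient := by exact_mod_cast Nat.totient_pos.2 (Nat.pos_of_neZero N)
  have hAb : ∀ s : ℂ, ‖s - s0‖ ≤ 4 * η → ‖LFunctionResidueClassAux a s‖ ≤ 1 / (4 * η) := by
    intro s hs
    obtain ⟨h1, h2, h3⟩ := H s hs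
    have hb : ‖-deriv (LFunctionTrivChar₁ N) s / LFunctionTrivChar₁ N s -
        ∑ χ ∈ ({1}ᶜ : Finset (DirichletCharacter ℂ N)),
          χ a⁻¹ * deriv (LFunction χ) s / LFunction χ s‖ ≤ N.totient * (1 / (4 * η)) := by
      refine (norm_sub_le _ _).trans ?_
      have b1 : ‖-deriv (LFunctionTrivChar₁ N) s / LFunctionTrivChar₁ N s‖ ≤ 1 / (4 * η) := by
        rw [neg_div, norm_neg]; exact h3
      have b2 : ‖∑ χ ∈ ({1}ᶜ : Finset (DirichletCharacter ℂ N)),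
          χ a⁻¹ * deriv (LFunction χ) s / LFunction χ s‖ ≤
          ∑ χ ∈ ({1}ᶜ : Finset (DirichletCharacter ℂ N)), 1 / (4 * η) := by
        refine norm_sum_le_of_le _ fun χ hχ => ?_
        have hχ1 : χ ≠ 1 := by simpa using hχ
        rw [mul_div_assoc, norm_mul]
        calc _ ≤ 1 * (1 / (4 * η)) := by
              gcongr
              · exact DirichletCharacter.norm_le_one χ _
              · exact (h1 χ hχ1).2
          _ = _ := one_mul _
      rw [Finset.sum_const, nsmul_eq_mul] at b2
      rw [← hcard, add_mul, one_mul]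
      linarith
    simp only [LFunctionResidueClassAux]
    rw [norm_mul, norm_inv, Complex.norm_natCast]
    rw [inv_mul_le_iff₀ hφ]
    refine le_trans (le_of_eq ?_) hb
    congr!
  have hAd : DiffContOnCl ℂ (LFunctionResidueClassAux a) (Metric.ball s0 (4 * η)) := by
    refine DifferentiableOn.diffContOnCl ?_
    rw [closure_ball _ (by positivity)]
    intro s hs
    obtain ⟨h1, h2, h3⟩ := H s (by simpa [dist_eq_norm] using hs)
    refine DifferentiableAt.differentiableWithinAt ?_
    have hd := differentiable_LFunctionTrivChar₁ N
    refine DifferentiableAt.const_mul ?_ _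
    refine DifferentiableAt.sub ?_ ?_
    · exact ((hd.deriv s).neg).div (hd s) h2
    · refine DifferentiableAt.fun_sum fun χ hχ => ?_
      have hχ1 : χ ≠ 1 := by simpa using hχ
      have hdχ := differentiable_LFunction hχ1
      exact ((hdχ.deriv s).const_mul _).div (hdχ s) (h1 χ hχ1).1
  have hcauchy := Complex.norm_iteratedDeriv_le_of_forall_mem_sphere_norm_le K
    (by positivity : 0 < 4 * η) hAd (fun z hz => hAb z (by
      have : ‖z - s0‖ = 4 * η := by simpa [dist_eq_norm] using hz
      exact this.le))
  have hs01 : s0 - 1 = (η : ℂ) := by simp [hs0]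
  have heq : iteratedDeriv K (LFunctionResidueClassAux a) s0 =
      (-1) ^ K * (((∑' n, esTerm a K η n : ℝ) : ℂ) -
        (N.totient : ℂ)⁻¹ * K.factorial / (η : ℂ) ^ (K + 1)) := by
    have hev : LFunctionResidueClassAux a =ᶠ[nhds s0]
        (fun s ↦ LSeries f s - (N.totient : ℂ)⁻¹ / (s - 1)) := by
      have : {s : ℂ | 1 < s.re} ∈ nhds s0 :=
        (isOpen_lt continuous_const Complex.continuous_re).mem_nhds (by
          show 1 < s0.re
          rw [hs0re]; linarith)
      exact Filter.eventuallyEq_of_mem this (eqOn_LFunctionResidueClassAux ha)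
    rw [hev.iteratedDeriv_eq K, iteratedDeriv_fun_sub, LSeries_iteratedDeriv K habs, es_iter_inv,
      hLS, hs01]
    · have hη' : (η : ℂ) ≠ 0 := by exact_mod_cast hη.ne'
      have : (η : ℂ) ^ (-1 - (K : ℤ)) = ((η : ℂ) ^ (K + 1))⁻¹ := by
        rw [← zpow_natCast, ← zpow_neg]; congr 1; push_cast; ring
      rw [this]
      field_simp
    · exact (LSeries_analyticOnNhd f s0 habs).contDiffAt
    · refine ContDiffAt.div contDiffAt_const (by fun_prop) ?_
      rw [hs01]; exact_mod_cast hη.ne'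
  rw [heq, norm_mul, norm_pow, norm_neg, norm_one, one_pow, one_mul] at hcauchy
  have hfin : (((∑' n, esTerm a K η n : ℝ) : ℂ) -
        (N.totient : ℂ)⁻¹ * K.factorial / (η : ℂ) ^ (K + 1)) =
      ((∑' n, esTerm a K η n - (N.totient : ℝ)⁻¹ * K.factorial / η ^ (K + 1) : ℝ) : ℂ) := by
    push_cast; rfl
  rw [hfin, Complex.norm_real, Real.norm_eq_abs] at hcauchy
  exact hcauchy

/-- the von Mangoldt function on non-primes, with weight `n ^ (-3/4)` -/
noncomputable def esF0 (n : ℕ) : ℝ :=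
  (if n.Prime then 0 else ArithmeticFunction.vonMangoldt n) * (n : ℝ) ^ (-(3 / 4) : ℝ)

lemma esF0_nonneg (n : ℕ) : 0 ≤ esF0 n := by
  unfold esF0
  have := ArithmeticFunction.vonMangoldt_nonneg (n := n)
  split_ifs <;> positivity

lemma esF0_le (p : Nat.Primes) (k : ℕ) :
    esF0 ((p : ℕ) ^ (k + 1 + 1)) ≤
      8 * ((p : ℝ) ^ (-(11 / 8) : ℝ) * ((2 : ℝ) ^ (-(3 / 4) : ℝ)) ^ k) := by
  have hp0 : (0 : ℝ) < p := by exact_mod_cast p.prop.pos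
  have hp2 : (2 : ℝ) ≤ p := by exact_mod_cast p.prop.two_le
  have h1 : esF0 ((p : ℕ) ^ (k + 1 + 1)) = Real.log p * ((p : ℝ) ^ (-(3 / 4) : ℝ)) ^ (k + 2) := by
    unfold esF0
    rw [if_neg (Nat.Prime.not_prime_pow (by omega)),
      ArithmeticFunction.vonMangoldt_apply_pow (by omega),
      ArithmeticFunction.vonMangoldt_apply_prime p.prop]
    congr 1
    push_cast
    rw [← Real.rpow_natCast, ← Real.rpow_natCast, ← Real.rpow_mul hp0.le, ← Real.rpow_mul hp0.le]
    congr 1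
    push_cast
    ring
  have h2 : Real.log p ≤ 8 * (p : ℝ) ^ (1 / 8 : ℝ) := by
    have := Real.log_le_rpow_div hp0.le (by norm_num : (0 : ℝ) < 1 / 8)
    linarith
  have h3 : (p : ℝ) ^ (-(3 / 4) : ℝ) ≤ (2 : ℝ) ^ (-(3 / 4) : ℝ) :=
    Real.rpow_le_rpow_of_nonpos (by norm_num) hp2 (by norm_num)
  have h4 : (p : ℝ) ^ (1 / 8 : ℝ) * ((p : ℝ) ^ (-(3 / 4) : ℝ)) ^ 2 = (p : ℝ) ^ (-(11 / 8) : ℝ) := by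
    rw [← Real.rpow_natCast, ← Real.rpow_mul hp0.le, ← Real.rpow_add hp0]
    norm_num
  rw [h1, pow_add, ← h4]
  calc _ ≤ (8 * (p : ℝ) ^ (1 / 8 : ℝ)) * (((2 : ℝ) ^ (-(3 / 4) : ℝ)) ^ k *
        ((p : ℝ) ^ (-(3 / 4) : ℝ)) ^ 2) := by gcongr
    _ = _ := by ring

lemma esF0_summable : Summable esF0 := by
  refine (summable_subtype_iff_indicator (s := {n | IsPrimePow n}).mp ?_).congr
      fun n ↦ Set.indicator_apply_eq_self.mpr fun (hn : ¬ IsPrimePow n) ↦ ?_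
  swap
  · unfold esF0
    rw [ArithmeticFunction.vonMangoldt_eq_zero_iff.mpr hn]
    simp
  have hFF' : esF0 ∘ Subtype.val (p := fun n ↦ n ∈ {n | IsPrimePow n}) =
      (fun pk : Nat.Primes × ℕ => esF0 ((pk.1 : ℕ) ^ (pk.2 + 1))) ∘
        ⇑Nat.Primes.prodNatEquiv.symm := by
    refine (Equiv.eq_comp_symm Nat.Primes.prodNatEquiv (esF0 ∘ Subtype.val) _).mpr ?_
    ext1 n
    simp only [Function.comp_apply]
    congr
  rw [hFF']
  refine (Nat.Primes.prodNatEquiv.symm.summable_iff).mpr ?_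
  have hs : Summable (fun pk : Nat.Primes × ℕ => esF0 ((pk.1 : ℕ) ^ (pk.2 + 1 + 1))) := by
    refine Summable.of_nonneg_of_le (fun _ => esF0_nonneg _) (fun pk => esF0_le pk.1 pk.2) ?_
    refine Summable.mul_left 8 ?_
    refine Summable.mul_of_nonneg (f := fun p : Nat.Primes => (p : ℝ) ^ (-(11 / 8) : ℝ))
      (g := fun k : ℕ => ((2 : ℝ) ^ (-(3 / 4) : ℝ)) ^ k) ?_ ?_ ?_ ?_
    · exact Nat.Primes.summable_rpow.mpr (by norm_num)
    · refine summable_geometric_of_lt_one (by positivity) ?_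
      exact Real.rpow_lt_one_of_one_lt_of_neg (by norm_num) (by norm_num)
    · intro p; positivity
    · intro k; positivity
  refine (Function.Injective.summable_iff
    (g := (Prod.map id (· + 1) : Nat.Primes × ℕ → Nat.Primes × ℕ)) ?_ fun u hu ↦ ?_).mp hs
  · exact Function.Injective.prodMap (fun ⦃a₁ a₂⦄ a ↦ a) <| add_left_injective 1
  · simp only [Set.range_prodMap, Set.range_id, Set.mem_prod, Set.mem_univ, Set.mem_range,
      Nat.exists_add_one_eq, true_and, not_lt, nonpos_iff_eq_zero] at hu
    simp [hu, esF0, u.1.prop]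

open ArithmeticFunction.vonMangoldt in
lemma esTerm_le {N : ℕ} (a : ZMod N) (K : ℕ) {η : ℝ} (hη : 0 < η) (hη1 : η ≤ 1 / 100) (n : ℕ)
    (h : n.Prime → (n : ZMod N) = a → 12 * K / η < Real.log n) :
    esTerm a K η n ≤ K.factorial / (4 * η) ^ K * (esF0 n + esTerm a 0 (η / 2) n) := by
  have hr0 := residueClass_nonneg a n
  have hF := esF0_nonneg n
  have hM : (0 : ℝ) ≤ K.factorial / (4 * η) ^ K := by positivity
  have hT0 : 0 ≤ esTerm a 0 (η / 2) n := by unfold esTerm; positivity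
  by_cases hn0 : residueClass a n = 0
  · have : esTerm a K η n = 0 := by unfold esTerm; rw [hn0]; ring
    rw [this]; positivity
  have hn : n ≠ 0 := by
    rintro rfl
    exact hn0 (residueClass_apply_zero a)
  have hnpos : (0 : ℝ) < n := by exact_mod_cast Nat.pos_of_ne_zero hn
  have hn1 : (1 : ℝ) ≤ n := by exact_mod_cast Nat.one_le_iff_ne_zero.mpr hn
  have hL : 0 ≤ Real.log n := Real.log_nonneg hn1
  have hexp : ∀ x : ℝ, Real.exp (Real.log n * x) = (n : ℝ) ^ x := fun x =>
    (Real.rpow_def_of_pos hnpos x).symm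
  by_cases hp : n.Prime
  · have hna : (n : ZMod N) = a := by
      by_contra hcon
      exact hn0 (Set.indicator_of_notMem (by simpa using hcon) _)
    have hlog := h hp hna
    have key : Real.log n ^ K * (n : ℝ) ^ (-(1 + η)) ≤
        K.factorial / (4 * η) ^ K * (n : ℝ) ^ (-(1 + η / 2)) := by
      have h1 := Real.pow_div_factorial_le_exp (Real.log n * (η / 4)) (by positivity) K
      rw [div_le_iff₀ (by positivity), mul_pow, hexp] at h1
      have h2 : (n : ℝ) ^ (η / 4) * (n : ℝ) ^ (-(1 + η)) =
          (n : ℝ) ^ (-(η / 4)) * (n : ℝ) ^ (-(1 + η / 2)) := by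
        rw [← Real.rpow_add hnpos, ← Real.rpow_add hnpos]; congr 1; ring
      have h3 : (n : ℝ) ^ (-(η / 4)) ≤ (1 / 16) ^ K := by
        rw [← hexp]
        have : Real.exp (-3) ≤ 1 / 16 := by
          rw [Real.exp_neg, one_div]
          apply inv_anti₀ (by norm_num)
          have h4 : Real.exp 3 = Real.exp 1 ^ 3 := by rw [← Real.exp_nat_mul]; norm_num
          rw [h4]
          have := Real.exp_one_gt_d9
          calc (16 : ℝ) ≤ 2.7 ^ 3 := by norm_num
            _ ≤ _ := by gcongr; linarith
        calc _ ≤ Real.exp (K * (-3)) := by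
              apply Real.exp_le_exp.mpr
              rw [div_lt_iff₀ hη] at hlog
              nlinarith
          _ = Real.exp (-3) ^ K := by rw [Real.exp_nat_mul]
          _ ≤ _ := by gcongr
      have h4 : Real.log n ^ K = Real.log n ^ K * (η / 4) ^ K * ((4 / η) ^ K) := by
        rw [mul_assoc, ← mul_pow]
        have : η / 4 * (4 / η) = 1 := by field_simp
        rw [this]; simp
      rw [h4]
      calc _ ≤ (n : ℝ) ^ (η / 4) * K.factorial * (4 / η) ^ K * (n : ℝ) ^ (-(1 + η)) := by gcongr
        _ = K.factorial * (4 / η) ^ K * ((n : ℝ) ^ (η / 4) * (n : ℝ) ^ (-(1 + η))) := by ring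
        _ = K.factorial * (4 / η) ^ K * ((n : ℝ) ^ (-(η / 4)) * (n : ℝ) ^ (-(1 + η / 2))) := by
          rw [h2]
        _ ≤ K.factorial * (4 / η) ^ K * ((1 / 16) ^ K * (n : ℝ) ^ (-(1 + η / 2))) := by gcongr
        _ = K.factorial * ((4 / η) ^ K * (1 / 16) ^ K) * (n : ℝ) ^ (-(1 + η / 2)) := by ring
        _ = _ := by
          rw [← mul_pow, div_eq_mul_inv (K.factorial : ℝ), ← inv_pow]
          congr 3
          field_simp; norm_num
    have : esTerm a K η n ≤ K.factorial / (4 * η) ^ K * esTerm a 0 (η / 2) n := by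
      unfold esTerm
      rw [pow_zero, mul_one, mul_assoc]
      calc _ ≤ residueClass a n * (K.factorial / (4 * η) ^ K * (n : ℝ) ^ (-(1 + η / 2))) := by
            gcongr
        _ = _ := by ring
    refine this.trans ?_
    gcongr
    linarith
  · have h1 := Real.pow_div_factorial_le_exp (Real.log n * (1 / 4)) (by positivity) K
    rw [div_le_iff₀ (by positivity), mul_pow, hexp] at h1
    have h5 : (n : ℝ) ^ (-(1 + η)) ≤ (n : ℝ) ^ (-1 : ℝ) :=
      Real.rpow_le_rpow_of_exponent_le hn1 (by linarith)
    have h2 : (n : ℝ) ^ (1 / 4 : ℝ) * (n : ℝ) ^ (-1 : ℝ) = (n : ℝ) ^ (-(3 / 4) : ℝ) := by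
      rw [← Real.rpow_add hnpos]; norm_num
    have h4 : Real.log n ^ K = Real.log n ^ K * (1 / 4) ^ K * 4 ^ K := by
      rw [mul_assoc, ← mul_pow]; norm_num
    have h6 : (4 : ℝ) ^ K ≤ ((4 * η) ^ K)⁻¹ := by
      rw [← inv_pow]
      gcongr
      rw [le_inv_comm₀ (by norm_num) (by positivity)]
      linarith
    have hle := residueClass_le a n
    have : esTerm a K η n ≤ K.factorial / (4 * η) ^ K * esF0 n := by
      unfold esTerm esF0
      rw [if_neg hp, h4, ← h2]
      calc _ ≤ ArithmeticFunction.vonMangoldt n * ((n : ℝ) ^ (1 / 4 : ℝ) * K.factorial * 4 ^ K) *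
            (n : ℝ) ^ (-1 : ℝ) := by gcongr
        _ ≤ ArithmeticFunction.vonMangoldt n *
            ((n : ℝ) ^ (1 / 4 : ℝ) * K.factorial * ((4 * η) ^ K)⁻¹) *
            (n : ℝ) ^ (-1 : ℝ) := by
              have := ArithmeticFunction.vonMangoldt_nonneg (n := n)
              gcongr
        _ = _ := by ring
    refine this.trans ?_
    gcongr
    linarith

lemma es_linnik (q : ℕ) [NeZero q] (hq2 : 2 ∣ q) : ∃ C : ℝ, 0 < C ∧
    ∀ k N : ℕ, 3 ≤ k → N = q ^ k → ∀ a : ZMod N, IsUnit a →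
      ∃ p : ℕ, p.Prime ∧ (p : ZMod N) = a ∧ Real.log p ≤ C * k ^ 10 := by
  obtain ⟨c, hc, hc1, H⟩ := es_zero_free q hq2
  set C2 : ℝ := ∑' n, esF0 n with hC2
  have hC20 : 0 ≤ C2 := tsum_nonneg esF0_nonneg
  obtain ⟨B, hB⟩ : ∃ B : ℕ, (q : ℝ) * (C2 + 4) < 4 ^ B :=
    pow_unbounded_of_one_lt _ (by norm_num)
  have hq0 : 0 < q := Nat.pos_of_neZero q
  have hq1 : (0 : ℝ) < q := by exact_mod_cast hq0
  refine ⟨12 * (B + 1) / c, by positivity, ?_⟩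
  intro k N hk hN a ha
  have : NeZero N := ⟨by rw [hN]; positivity⟩
  have hN0 : 0 < N := Nat.pos_of_neZero N
  have hk0 : (0 : ℝ) < k := by exact_mod_cast (by omega : 0 < k)
  have hk1 : (1 : ℝ) ≤ k := by exact_mod_cast (by omega : 1 ≤ k)
  by_contra! hcon
  set η : ℝ := c / k ^ 9 with hη
  have hη0 : 0 < η := by positivity
  have hη1 : η ≤ 1 / 100 := by
    refine le_trans ?_ hc1
    rw [hη, div_le_iff₀ (by positivity)]
    have : (1 : ℝ) ≤ k ^ 9 := one_le_pow₀ hk1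
    nlinarith
  set K : ℕ := B * k with hK
  obtain ⟨hs1, ht1⟩ := es_taylor ha K hη0 (H k N hk hN η hη0 le_rfl)
  obtain ⟨hs2, ht2⟩ := es_taylor ha 0 (half_pos hη0)
    (fun s hs => H k N hk hN (η / 2) (half_pos hη0) (by linarith) s (by exact_mod_cast hs))
  have hφ0 : (0 : ℝ) < N.totient := by exact_mod_cast Nat.totient_pos.2 hN0
  have hφ1 : (1 : ℝ) ≤ N.totient := by exact_mod_cast Nat.totient_pos.2 hN0
  have hφN : (N.totient : ℝ) ≤ N := by exact_mod_cast Nat.totient_le N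
  have hT : ∑' n, esTerm a 0 (η / 2) n ≤ 3 / η := by
    have h1 := (abs_le.mp ht2).2
    have h2 : (N.totient : ℝ)⁻¹ ≤ 1 := inv_le_one_of_one_le₀ hφ1
    have h3 : (N.totient : ℝ)⁻¹ * ((0 : ℕ).factorial : ℝ) / (η / 2) ^ (0 + 1) ≤ 2 / η := by
      simp only [Nat.factorial_zero, Nat.cast_one, mul_one, zero_add, pow_one]
      calc _ ≤ 1 / (η / 2) := by gcongr
        _ = _ := by field_simp
    have h4 : ((0 : ℕ).factorial : ℝ) * (1 / (4 * (η / 2))) / (4 * (η / 2)) ^ 0 ≤ 1 / η := by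
      simp only [Nat.factorial_zero, Nat.cast_one, one_mul, pow_zero, div_one]
      apply one_div_le_one_div_of_le hη0; linarith
    have : 3 / η = 2 / η + 1 / η := by ring
    linarith
  have hle : ∀ n, esTerm a K η n ≤ K.factorial / (4 * η) ^ K * (esF0 n + esTerm a 0 (η / 2) n) := by
    intro n
    refine esTerm_le a K hη0 hη1 n fun hp hna => ?_
    refine lt_of_le_of_lt ?_ (hcon n hp hna)
    rw [hK, hη]
    push_cast
    rw [div_div_eq_mul_div, div_mul_eq_mul_div, div_le_div_iff_of_pos_right hc]
    have : (0 : ℝ) ≤ k ^ 10 := by positivity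
    calc _ = 12 * (B : ℝ) * k ^ 10 := by ring
      _ ≤ _ := by nlinarith
  have hS : ∑' n, esTerm a K η n ≤ K.factorial / (4 * η) ^ K * (C2 + 3 / η) := by
    calc _ ≤ ∑' n, K.factorial / (4 * η) ^ K * (esF0 n + esTerm a 0 (η / 2) n) :=
          hs1.tsum_le_tsum hle ((esF0_summable.add hs2).mul_left _)
      _ = K.factorial / (4 * η) ^ K * (C2 + ∑' n, esTerm a 0 (η / 2) n) := by
          rw [tsum_mul_left, esF0_summable.tsum_add hs2]
      _ ≤ _ := by gcongr
  have hlow := (abs_le.mp ht1).1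
  have hfac : (0 : ℝ) < K.factorial := by exact_mod_cast K.factorial_pos
  have hNinv : (N : ℝ)⁻¹ ≤ (N.totient : ℝ)⁻¹ := inv_anti₀ hφ0 hφN
  have hmain : (N : ℝ)⁻¹ * K.factorial / η ^ (K + 1) ≤
      K.factorial * (1 / (4 * η)) / (4 * η) ^ K + K.factorial / (4 * η) ^ K * (C2 + 3 / η) := by
    have : (N : ℝ)⁻¹ * K.factorial / η ^ (K + 1) ≤
      (N.totient : ℝ)⁻¹ * K.factorial / η ^ (K + 1) := by gcongr
    linarith
  have hmain2 : (N : ℝ)⁻¹ ≤ (C2 + 4) / 4 ^ K := by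
    have e1 : (N : ℝ)⁻¹ = (N : ℝ)⁻¹ * K.factorial / η ^ (K + 1) * (η ^ (K + 1) / K.factorial) := by
      field_simp
    rw [e1]
    calc _ ≤ (K.factorial * (1 / (4 * η)) / (4 * η) ^ K +
          K.factorial / (4 * η) ^ K * (C2 + 3 / η)) * (η ^ (K + 1) / K.factorial) := by gcongr
      _ = (1 / 4 + η * C2 + 3) / 4 ^ K := by
          rw [mul_pow, pow_succ]; field_simp
          try ring
      _ ≤ _ := by
          refine div_le_div_of_nonneg_right ?_ (by positivity)
          nlinarith
  have hfin : (4 : ℝ) ^ K ≤ q ^ k * (C2 + 4) := by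
    have hNq : (N : ℝ) = q ^ k := by rw [hN]; push_cast; rfl
    rw [hNq, inv_eq_one_div, div_le_div_iff₀ (by positivity) (by positivity)] at hmain2
    linarith
  have h1 : (q : ℝ) ^ k * (C2 + 4) ≤ (q * (C2 + 4)) ^ k := by
    rw [mul_pow]
    gcongr
    exact le_self_pow₀ (by linarith) (by omega)
  have h2 : ((q : ℝ) * (C2 + 4)) ^ k < (4 ^ B) ^ k :=
    pow_lt_pow_left₀ hB (by positivity) (by omega)
  rw [← pow_mul] at h2
  linarith

/-- every solution triple is bounded -/
lemma es_sol_bound (p x y z : ℕ) (hp : 0 < p) (hx : 0 < x) (hy : 0 < y) (hz : 0 < z)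
    (hxy : x ≤ y) (hyz : y ≤ z) (h : 4 * (x * y * z) = p * (y * z + x * z + x * y)) :
    z ≤ p * p * (2 * p * p) := by
  have h0 : x ≤ p := by
    have h1 : x * z ≤ y * z := Nat.mul_le_mul_right _ hxy
    have h2 : x * y ≤ y * z := by nlinarith
    have h3 : 4 * (x * y * z) ≤ p * (3 * (y * z)) := by
      rw [h]; exact Nat.mul_le_mul_left _ (by omega)
    have h4 : 4 * x * (y * z) ≤ 3 * p * (y * z) := by linarith
    have := Nat.le_of_mul_le_mul_right h4 (by positivity)
    omega
  have hpx : p < 4 * x := by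
    by_contra! hc
    have h1 : 4 * x * (y * z) ≤ p * (y * z) := Nat.mul_le_mul_right _ hc
    have h2 : 0 < p * (x * z) := by positivity
    nlinarith
  have h1 : y ≤ 2 * p * x := by
    have h2 : (p + 1) * (y * z) ≤ 4 * x * (y * z) := Nat.mul_le_mul_right _ hpx
    have h3 : x * y ≤ x * z := Nat.mul_le_mul_left _ hyz
    have h4 : p * (x * y) ≤ p * (x * z) := Nat.mul_le_mul_left _ h3
    have h5 : y * z ≤ 2 * p * x * z := by nlinarith
    exact Nat.le_of_mul_le_mul_right h5 hz
  have h2 : z ≤ p * x * y := by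
    have h3 : p * (y + x) < 4 * (x * y) := by
      by_contra! hc
      have h1 : 4 * (x * y) * z ≤ p * (y + x) * z := Nat.mul_le_mul_right _ hc
      have h2 : 0 < p * (x * y) := by positivity
      nlinarith
    have h4 : (p * (y + x) + 1) * z ≤ 4 * (x * y) * z := Nat.mul_le_mul_right _ h3
    nlinarith
  calc z ≤ p * x * y := h2
    _ ≤ p * p * (2 * p * p) := by
      have : y ≤ 2 * p * p := h1.trans (Nat.mul_le_mul_left _ h0)
      gcongr

lemma es_finite (p : ℕ) (hp : 0 < p) : Finite {a : Fin 3 → ℕ // (∀ i, 0 < a i) ∧ Monotone a ∧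
    ((4 : ℕ) : ℚ) / p = ∑ i, (1 : ℚ) / a i} := by
  have : Set.Finite {a : Fin 3 → ℕ | (∀ i, 0 < a i) ∧ Monotone a ∧
      ((4 : ℕ) : ℚ) / p = ∑ i, (1 : ℚ) / a i} := by
    refine (Set.finite_Icc (0 : Fin 3 → ℕ) (fun _ => p * p * (2 * p * p))).subset ?_
    rintro a ⟨h1, h2, h3⟩
    refine ⟨fun i => Nat.zero_le _, ?_⟩
    rw [Fin.sum_univ_three] at h3
    have p0 : (p : ℚ) ≠ 0 := by exact_mod_cast hp.ne'
    have a0 : (a 0 : ℚ) ≠ 0 := by exact_mod_cast (h1 0).ne'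
    have a1 : (a 1 : ℚ) ≠ 0 := by exact_mod_cast (h1 1).ne'
    have a2 : (a 2 : ℚ) ≠ 0 := by exact_mod_cast (h1 2).ne'
    have h4 : 4 * (a 0 * a 1 * a 2) = p * (a 1 * a 2 + a 0 * a 2 + a 0 * a 1) := by
      have : (4 : ℚ) * (a 0 * a 1 * a 2) = p * (a 1 * a 2 + a 0 * a 2 + a 0 * a 1) := by
        push_cast at h3
        field_simp at h3
        linarith
      exact_mod_cast this
    have hz := es_sol_bound p _ _ _ hp (h1 0) (h1 1) (h1 2) (h2 (by decide)) (h2 (by decide)) h4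
    intro i
    exact (h2 (Fin.le_last i)).trans hz
  exact this.to_subtype

lemma es_count (p e' n0 r0 Q : ℕ) (hp : 0 < p) (he : e' = 1 ∨ e' = 3) (hn : p + e' = 4 * n0)
    (hdiv : r0 * Q ∣ n0) (hr0 : r0 % 3 = 2) (hQ : ∀ g, g ∣ Q → g % 3 = 1) :
    Q.divisors.card ≤ numSols 3 4 p := by
  classical
  have hfin := es_finite p hp
  have hn0 : 0 < n0 := by omega
  have hr0pos : 0 < r0 := by omega
  have hn0p : n0 ≤ p := by omega
  have key : ∀ g : Q.divisors, ∃ d c : ℕ, n0 = r0 * g.1 * d ∧ r0 * g.1 + 1 = e' * c ∧ 0 < d ∧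
      0 < c := by
    rintro ⟨g, hg⟩
    have hgQ := Nat.dvd_of_mem_divisors hg
    obtain ⟨d, hd⟩ := (Nat.mul_dvd_mul_left r0 hgQ).trans hdiv
    have hm : e' ∣ r0 * g + 1 := by
      rcases he with rfl | rfl
      · exact one_dvd _
      · have := hQ g hgQ
        apply Nat.dvd_of_mod_eq_zero
        rw [Nat.add_mod, Nat.mul_mod, hr0, this]
    obtain ⟨c, hc⟩ := hm
    refine ⟨d, c, hd, hc, ?_, ?_⟩
    · rcases Nat.eq_zero_or_pos d with rfl | h
      · omega
      · exact h
    · rcases Nat.eq_zero_or_pos c with rfl | h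
      · omega
      · exact h
  choose d c hd hc hd0 hc0 using key
  have hmem : ∀ g : Q.divisors, (∀ i, 0 < (![n0, c g * d g * p, n0 * c g * p] : Fin 3 → ℕ) i) ∧
      Monotone (![n0, c g * d g * p, n0 * c g * p] : Fin 3 → ℕ) ∧
      ((4 : ℕ) : ℚ) / p =
        ∑ i, (1 : ℚ) / (![n0, c g * d g * p, n0 * c g * p] : Fin 3 → ℕ) i := by
    intro g
    have c0 := hc0 g
    have d0 := hd0 g
    have hcd : 1 ≤ c g * d g := Nat.mul_pos c0 d0
    have o1 : n0 ≤ c g * d g * p := by nlinarith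
    have o2 : c g * d g * p ≤ n0 * c g * p := by
      have : d g ≤ n0 := Nat.le_of_dvd hn0 ⟨r0 * g.1, by rw [hd g]; ring⟩
      calc c g * d g * p ≤ c g * n0 * p := by gcongr
        _ = _ := by ring
    refine ⟨?_, ?_, ?_⟩
    · intro i
      fin_cases i
      · exact hn0
      · show 0 < c g * d g * p
        positivity
      · show 0 < n0 * c g * p
        positivity
    · rw [Fin.monotone_iff_le_succ]
      intro i
      fin_cases i
      · exact o1
      · exact o2
    · rw [Fin.sum_univ_three]
      simp only [Matrix.cons_val_zero, Matrix.cons_val_one, Matrix.cons_val]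
      have q1 : (p : ℚ) + e' = 4 * n0 := by exact_mod_cast hn
      have q2 : (n0 : ℚ) = r0 * g.1 * d g := by exact_mod_cast hd g
      have q3 : (r0 : ℚ) * g.1 + 1 = e' * c g := by exact_mod_cast hc g
      have p0 : (p : ℚ) ≠ 0 := by exact_mod_cast hp.ne'
      have n00 : (n0 : ℚ) ≠ 0 := by exact_mod_cast hn0.ne'
      have c00 : (c g : ℚ) ≠ 0 := by exact_mod_cast c0.ne'
      have d00 : (d g : ℚ) ≠ 0 := by exact_mod_cast d0.ne'
      have q4 : (n0 : ℚ) + d g = d g * (e' * c g) := by rw [← q3, q2]; ring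
      have q5 : (4 : ℚ) / p = 1 / n0 + e' / (n0 * p) := by
        field_simp
        linarith
      have q6 : (1 : ℚ) / (c g * d g * p) + 1 / (n0 * c g * p) = e' / (n0 * p) := by
        field_simp
        linarith
      push_cast
      rw [add_assoc, q6, q5]
  have hinj : Function.Injective (fun g : Q.divisors =>
      (⟨![n0, c g * d g * p, n0 * c g * p], hmem g⟩ : {a : Fin 3 → ℕ // (∀ i, 0 < a i) ∧
        Monotone a ∧ ((4 : ℕ) : ℚ) / p = ∑ i, (1 : ℚ) / a i})) := by
    intro g g' h
    have h1 := congrFun (congrArg Subtype.val h) 2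
    have h2 : n0 * c g * p = n0 * c g' * p := h1
    have h3 : c g = c g' := Nat.eq_of_mul_eq_mul_left hn0 (Nat.eq_of_mul_eq_mul_right hp h2)
    have h4 : r0 * g.1 = r0 * g'.1 := by
      have := hc g
      have := hc g'
      rw [h3] at *
      omega
    exact Subtype.ext (Nat.eq_of_mul_eq_mul_left hr0pos h4)
  have := Nat.card_le_card_of_injective _ hinj
  rw [Nat.card_eq_fintype_card, Fintype.card_coe] at this
  exact this

lemma es_R (M : ℕ) (hM : 0 < M) (j : ℕ) : ∃ R : ℕ, 0 < R ∧ (∀ k g, g ∣ R ^ k → g ≡ 1 [MOD M]) ∧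
    ∀ k, (k + 1) ^ j ≤ (R ^ k).divisors.card := by
  induction j with
  | zero =>
    refine ⟨1, one_pos, ?_, ?_⟩
    · intro k g hg
      rw [one_pow, Nat.dvd_one] at hg
      rw [hg]
    · intro k; simp
  | succ j ih =>
    obtain ⟨R, hR, h1, h2⟩ := ih
    have : NeZero M := ⟨hM.ne'⟩
    obtain ⟨s, hs, hsp, hs1⟩ := Nat.forall_exists_prime_gt_and_eq_mod
      (q := M) (a := 1) isUnit_one R
    have hs1' : s ≡ 1 [MOD M] := by
      rw [← ZMod.natCast_eq_natCast_iff]; simpa using hs1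
    have hco : Nat.Coprime R s := by
      rw [Nat.coprime_comm, Nat.Prime.coprime_iff_not_dvd hsp]
      intro hd
      have := Nat.le_of_dvd hR hd
      omega
    refine ⟨R * s, by have := hsp.pos; positivity, ?_, ?_⟩
    · intro k g hg
      rw [mul_pow] at hg
      obtain ⟨g1, g2, hg1, hg2, rfl⟩ := exists_dvd_and_dvd_of_dvd_mul hg
      obtain ⟨i, hi, rfl⟩ := (Nat.dvd_prime_pow hsp).1 hg2
      have := (h1 k g1 hg1).mul (hs1'.pow i)
      simpa using this
    · intro k
      rw [mul_pow, (Nat.Coprime.pow k k hco).card_divisors_mul, Nat.divisors_prime_pow hsp]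
      rw [pow_succ]
      simp only [Finset.card_map, Finset.card_range]
      exact Nat.mul_le_mul_right _ (h2 k)

lemma es_nat (e f : ℕ) (hf : 0 < f) (hef : Nat.gcd e f = 1) : ∃ C : ℝ, 0 < C ∧
    ∀ k : ℕ, 3 ≤ k → ∃ p : ℕ, k ≤ p ∧ p.Prime ∧ p ≡ e [MOD f] ∧ Real.log p ≤ C * k ^ 10 ∧
      (k + 1) ^ 6 ≤ numSols 3 4 p := by
  obtain ⟨p0, hp0gt, hp0, hp0e⟩ : ∃ p0 > 4 * f, p0.Prime ∧ p0 ≡ e [MOD f] := by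
    have : NeZero f := ⟨hf.ne'⟩
    obtain ⟨s, hs, hsp, hs1⟩ := Nat.forall_exists_prime_gt_and_eq_mod
      (q := f) (a := (e : ZMod f)) ((ZMod.isUnit_iff_coprime e f).2 hef) (4 * f)
    exact ⟨s, hs, hsp, (ZMod.natCast_eq_natCast_iff _ _ _).1 hs1⟩
  have hp0co : Nat.Coprime p0 (4 * f) := by
    rw [Nat.Prime.coprime_iff_not_dvd hp0]
    intro hd
    have := Nat.le_of_dvd (by omega) hd
    omega
  obtain ⟨e', he', hpe⟩ : ∃ e', (e' = 1 ∨ e' = 3) ∧ 4 ∣ p0 + e' := by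
    have hodd := hp0.odd_of_ne_two (by omega)
    rw [Nat.odd_iff] at hodd
    have : p0 % 4 = 1 ∨ p0 % 4 = 3 := by omega
    rcases this with h | h
    · exact ⟨3, Or.inr rfl, by omega⟩
    · exact ⟨1, Or.inl rfl, by omega⟩
  obtain ⟨R, hR, hR1, hR2⟩ := es_R (12 * f) (by omega) 6
  obtain ⟨r0, hr0⟩ : ∃ r0, r0 + 1 = 12 * f := ⟨12 * f - 1, by omega⟩
  have hRM : R ≡ 1 [MOD 12 * f] := hR1 1 R (by simp)
  have hRco : Nat.Coprime R (12 * f) := by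
    have := hRM.gcd_eq
    simpa [Nat.Coprime] using this
  have hr0co : Nat.Coprime r0 (12 * f) := by
    rw [← hr0]; simp
  have hco12 : Nat.Coprime (r0 * R) (12 * f) := Nat.Coprime.mul_left hr0co hRco
  have hco4f : Nat.Coprime (r0 * R) (4 * f) :=
    hco12.coprime_dvd_right ⟨3, by ring⟩
  have hcoe : Nat.Coprime (r0 * R) e' := by
    refine hco12.coprime_dvd_right ?_
    rcases he' with rfl | rfl
    · exact one_dvd _
    · exact ⟨4 * f, by ring⟩
  set q : ℕ := (4 * f) * (r0 * R) with hq
  have hr0pos : 11 ≤ r0 := by omega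
  have hqpos : 0 < q := by positivity
  have : NeZero q := ⟨hqpos.ne'⟩
  obtain ⟨C, hC, hlin⟩ := es_linnik q ⟨2 * f * (r0 * R), by rw [hq]; ring⟩
  refine ⟨C, hC, fun k hk => ?_⟩
  set W : ℕ := (r0 * R) ^ k with hW
  have hW11 : 11 ^ k ≤ W := by
    rw [hW]
    apply Nat.pow_le_pow_left
    nlinarith
  have hk11 : k + 3 ≤ 11 ^ k := by
    clear * - hk
    induction k, hk using Nat.le_induction with
    | base => norm_num
    | succ k hk ih => rw [pow_succ]; omega
  have hcoW : Nat.Coprime ((4 * f) ^ k) W := (Nat.Coprime.pow k k hco4f).symm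
  obtain ⟨b, hb⟩ : ∃ b, b + e' = 3 * W := ⟨3 * W - e', by omega⟩
  have hbW : Nat.Coprime b W := by
    have h1 : Nat.gcd b W ∣ e' := by
      have h2 : Nat.gcd b W ∣ b + e' := by
        rw [hb]; exact (Nat.gcd_dvd_right b W).mul_left 3
      exact (Nat.dvd_add_right (Nat.gcd_dvd_left b W)).1 h2
    have h3 : Nat.Coprime W e' := Nat.Coprime.pow_left k hcoe
    exact Nat.eq_one_of_dvd_coprimes h3 (Nat.gcd_dvd_right b W) h1
  obtain ⟨c, hc1, hc2⟩ := Nat.chineseRemainder hcoW p0 b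
  have hcco : Nat.Coprime c (q ^ k) := by
    rw [hq, mul_pow]
    refine Nat.Coprime.mul_right ?_ ?_
    · have := hc1.gcd_eq
      unfold Nat.Coprime
      rw [this]
      exact Nat.Coprime.pow_right k hp0co
    · have := hc2.gcd_eq
      unfold Nat.Coprime
      rw [this]
      exact hbW
  obtain ⟨p, hp, hpc, hlog⟩ := hlin k (q ^ k) hk rfl (c : ZMod (q ^ k))
    ((ZMod.isUnit_iff_coprime _ _).2 hcco)
  have hpc' : p ≡ c [MOD q ^ k] := (ZMod.natCast_eq_natCast_iff _ _ _).1 hpc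
  have hp1 : p ≡ p0 [MOD (4 * f) ^ k] :=
    (hpc'.of_dvd ⟨W, by rw [hq, mul_pow]⟩).trans hc1
  have hp2 : p ≡ b [MOD W] :=
    (hpc'.of_dvd ⟨(4 * f) ^ k, by rw [hq, mul_pow, mul_comm]⟩).trans hc2
  have hp4f : p ≡ p0 [MOD 4 * f] := hp1.of_dvd (dvd_pow_self _ (by omega))
  have h4 : 4 ∣ p + e' := by
    have h1 : p ≡ p0 [MOD 4] := hp4f.of_dvd ⟨f, rfl⟩
    have h2 := h1.add_right e'
    exact (h2.dvd_iff (dvd_refl 4)).2 hpe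
  have hWd : W ∣ p + e' := by
    have h2 := hp2.add_right e'
    exact (h2.dvd_iff (dvd_refl W)).2 (by rw [hb]; exact Dvd.intro_left 3 rfl)
  obtain ⟨n0, hn0⟩ := h4
  have hWn : W ∣ n0 := by
    rw [hn0] at hWd
    refine Nat.Coprime.dvd_of_dvd_mul_left ?_ hWd
    exact Nat.Coprime.pow_left k (hco4f.coprime_dvd_right ⟨f, rfl⟩)
  have hge : k ≤ p := by
    have : W ≤ p + e' := Nat.le_of_dvd (by have := hp.pos; omega) hWd
    omega
  refine ⟨p, hge, hp, ?_, hlog, ?_⟩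
  · exact (hp4f.of_dvd ⟨4, by ring⟩).trans hp0e
  · refine (hR2 k).trans ?_
    refine es_count p e' n0 r0 (R ^ k) hp.pos he' hn0 ?_ (by omega) ?_
    · refine Dvd.dvd.trans ?_ hWn
      rw [hW, mul_pow]
      exact Nat.mul_dvd_mul_right (dvd_pow_self _ (by omega)) _
    · intro g hg
      have := (hR1 k g hg).of_dvd (m := 3) ⟨4 * f, by ring⟩
      simpa [Nat.ModEq] using this

theorem stmt_10 (e f : ℕ) (he : 0 < e) (hf : 0 < f) (hef : Nat.gcd e f = 1) :
    ∃ c : ℝ, 0 < c ∧ ∀ N : ℕ, ∃ p : ℕ, N ≤ p ∧ p.Prime ∧ p ≡ e [MOD f] ∧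
      c * (Real.log p) ^ (0.549 : ℝ) ≤ (numSols 3 4 p : ℝ) := by
  obtain ⟨C, hC, H⟩ := es_nat e f hf hef
  have hC' : 0 < C ^ (0.549 : ℝ) := Real.rpow_pos_of_pos hC _
  refine ⟨(C ^ (0.549 : ℝ))⁻¹, inv_pos.2 hC', fun N => ?_⟩
  obtain ⟨p, hkp, hp, hpe, hlog, hnum⟩ := H (max N 3) (le_max_right _ _)
  refine ⟨p, (le_max_left _ _).trans hkp, hp, hpe, ?_⟩
  set k := max N 3 with hk
  have hk1 : (1 : ℝ) ≤ k := by
    have : 3 ≤ k := le_max_right _ _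
    exact_mod_cast (by omega : 1 ≤ k)
  have hl0 : 0 ≤ Real.log p := Real.log_natCast_nonneg p
  have h1 : Real.log p ^ (0.549 : ℝ) ≤ C ^ (0.549 : ℝ) * (k : ℝ) ^ (6 : ℕ) := by
    calc _ ≤ (C * (k : ℝ) ^ 10) ^ (0.549 : ℝ) := Real.rpow_le_rpow hl0 hlog (by norm_num)
      _ = C ^ (0.549 : ℝ) * ((k : ℝ) ^ 10) ^ (0.549 : ℝ) :=
          Real.mul_rpow hC.le (by positivity)
      _ ≤ _ := by
          gcongr
          rw [← Real.rpow_natCast, ← Real.rpow_natCast, ← Real.rpow_mul (by linarith)]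
          apply Real.rpow_le_rpow_of_exponent_le hk1
          norm_num
  rw [inv_mul_le_iff₀ hC']
  refine h1.trans ?_
  gcongr
  calc (k : ℝ) ^ 6 ≤ ((k : ℝ) + 1) ^ 6 := by gcongr; linarith
    _ ≤ _ := by exact_mod_cast hnum
end
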